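/- arXiv:1304.5468 — 2 statements merged into one kernel-verified Lean document; each statement's English description precedes it below -/
import Mathlib

section
/- Every finite simple graph with no K_7-minor has chromatic number at most 8. -/
open SimpleGraph

/-- `H` is a minor of `G`: there is a family of nonempty, pairwise disjoint,
connected branch sets in `G`, one for each vertex of `H`, with an edge of `G`
between the branch sets corresponding to each edge of `H`. -/
def SimpleGraph.MinorOf {W V : Type} (H : SimpleGraph W) (G : SimpleGraph V) : Prop :=
  ∃ f : W → Set V,
    (∀ w, (f w).Nonempty) ∧
    (∀ w, (G.induce (f w)).Connected) ∧
    (∀ w₁ w₂, w₁ ≠ w₂ → Disjoint (f w₁) (f w₂)) ∧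
    (∀ w₁ w₂, H.Adj w₁ w₂ → ∃ v₁ ∈ f w₁, ∃ v₂ ∈ f w₂, G.Adj v₁ v₂)

namespace CliqueMinor

open Relation Finset
open scoped Classical

variable {V : Type}

/-! ### Connected vertex sets -/

/-- `x` and `y` are joined by a walk all of whose edges lie inside `S`. -/
def Joined (G : SimpleGraph V) (S : Finset V) : V → V → Prop :=
  ReflTransGen fun x y => G.Adj x y ∧ x ∈ S ∧ y ∈ S

/-- The set `S` is nonempty and induces a connected subgraph. -/
def ConnOn (G : SimpleGraph V) (S : Finset V) : Prop :=
  S.Nonempty ∧ ∀ x ∈ S, ∀ y ∈ S, Joined G S x y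

/-- The component of `z` in the subgraph induced by `S`. -/
noncomputable def comp (G : SimpleGraph V) (S : Finset V) (z : V) : Finset V :=
  {w ∈ S | Joined G S z w}

variable {G G' : SimpleGraph V} {S T A B C R R' : Finset V} {x y z u v w : V} {k n : ℕ}

lemma Joined.symm (h : Joined G S x y) : Joined G S y x := by
  have : Std.Symm fun x y => G.Adj x y ∧ x ∈ S ∧ y ∈ S := ⟨fun _ _ h => ⟨h.1.symm, h.2.2, h.2.1⟩⟩
  exact Std.Symm.symm (r := ReflTransGen fun x y => G.Adj x y ∧ x ∈ S ∧ y ∈ S) _ _ h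

lemma Joined.mono (h : Joined G S x y) (hST : S ⊆ T) : Joined G T x y :=
  ReflTransGen.mono (fun _ _ h => ⟨h.1, hST h.2.1, hST h.2.2⟩) _ _ h

lemma Joined.of_adj (h : G.Adj x y) (hx : x ∈ S) (hy : y ∈ S) : Joined G S x y :=
  ReflTransGen.single ⟨h, hx, hy⟩

lemma comp_subset : comp G S z ⊆ S := filter_subset _ _

lemma mem_comp_self (hz : z ∈ S) : z ∈ comp G S z := by
  simp only [comp, mem_filter]; exact ⟨hz, ReflTransGen.refl⟩

lemma mem_comp_of_adj (hx : x ∈ comp G S z) (h : G.Adj x y) (hy : y ∈ S) : y ∈ comp G S z := by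
  simp only [comp, mem_filter] at *
  exact ⟨hy, hx.2.tail ⟨h, hx.1, hy⟩⟩

lemma joined_comp (h : Joined G S z x) : Joined G (comp G S z) z x := by
  induction h with
  | refl => exact ReflTransGen.refl
  | @tail b c hb hbc ih =>
    have hb' : b ∈ comp G S z := mem_filter.2 ⟨hbc.2.1, hb⟩
    exact ih.tail ⟨hbc.1, hb', mem_comp_of_adj hb' hbc.1 hbc.2.2⟩

lemma connOn_comp (hz : z ∈ S) : ConnOn G (comp G S z) := by
  refine ⟨⟨z, mem_comp_self hz⟩, fun x hx y hy => ?_⟩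
  have hx' := joined_comp (mem_filter.1 hx).2
  have hy' := joined_comp (mem_filter.1 hy).2
  exact hx'.symm.trans hy'

lemma connOn_singleton (v : V) : ConnOn G {v} := by
  refine ⟨⟨v, mem_singleton_self v⟩, fun x hx y hy => ?_⟩
  rw [mem_singleton.1 hx, mem_singleton.1 hy]; exact ReflTransGen.refl

lemma ConnOn.union (h : ConnOn G S) (h' : ConnOn G T) (hx : x ∈ S) (hy : y ∈ T)
    (hxy : x = y ∨ G.Adj x y) : ConnOn G (S ∪ T) := by
  have key : ∀ z ∈ S ∪ T, Joined G (S ∪ T) x z := by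
    intro z hz
    rcases mem_union.1 hz with hz | hz
    · exact (h.2 x hx z hz).mono subset_union_left
    · refine ReflTransGen.trans ?_ ((h'.2 y hy z hz).mono subset_union_right)
      rcases hxy with rfl | hxy
      · exact ReflTransGen.refl
      · exact Joined.of_adj hxy (mem_union_left _ hx) (mem_union_right _ hy)
  exact ⟨⟨x, mem_union_left _ hx⟩, fun a ha b hb => (key a ha).symm.trans (key b hb)⟩

/-- A walk that reaches `y` enters `y` from the component of its start in the set without `y`. -/
lemma exists_adj_of_joined (h : Joined G S x y) (hx : x ∈ S) (hxy : x ≠ y) :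
    ∃ p ∈ comp G (S.erase y) x, G.Adj p y := by
  have key : ∀ z, Joined G S x z →
      z ∈ comp G (S.erase y) x ∨ ∃ p ∈ comp G (S.erase y) x, G.Adj p y := by
    intro z hz
    induction hz with
    | refl => exact Or.inl (mem_comp_self (mem_erase.2 ⟨hxy, hx⟩))
    | @tail b c _ hbc ih =>
      rcases ih with ih | ih
      · by_cases hc : c = y
        · subst hc; exact Or.inr ⟨b, ih, hbc.1⟩
        · exact Or.inl (mem_comp_of_adj ih hbc.1 (mem_erase.2 ⟨hc, hbc.2.2⟩))
      · exact Or.inr ih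
  rcases key y h with h | h
  · simpa using comp_subset h
  · exact h

lemma comp_mono (h : S ⊆ T) : comp G S z ⊆ comp G T z := fun _ hx =>
  mem_filter.2 ⟨h (mem_filter.1 hx).1, (mem_filter.1 hx).2.mono h⟩

lemma ConnOn.induce_connected (h : ConnOn G S) : (G.induce (S : Set V)).Connected := by
  obtain ⟨x, hx⟩ := h.1
  have : Nonempty (S : Set V) := ⟨⟨x, hx⟩⟩
  refine SimpleGraph.Connected.mk ?_
  rintro ⟨a, ha⟩ ⟨b, hb⟩
  have key : ∀ b, Joined G S a b → ∀ hb : b ∈ S,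
      (G.induce (S : Set V)).Reachable ⟨a, ha⟩ ⟨b, hb⟩ := by
    intro b hab
    induction hab with
    | refl => intro _; exact Reachable.refl _
    | tail _ h ih => exact fun hc => (ih h.2.1).trans (Adj.reachable (by simpa using h.1))
  exact key b (h.2 a ha b hb) hb

/-! ### Complete minors inside a vertex set -/

/-- A `K_k`-minor of `G` with branch sets inside `S`, each of which meets `R`. -/
def RootedKMinor (G : SimpleGraph V) (k : ℕ) (S R : Finset V) : Prop :=
  ∃ f : Fin k → Finset V, (∀ i, f i ⊆ S) ∧ (∀ i, ConnOn G (f i)) ∧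
    (∀ i j, i ≠ j → Disjoint (f i) (f j)) ∧
    (∀ i j, i ≠ j → ∃ x ∈ f i, ∃ y ∈ f j, G.Adj x y) ∧ ∀ i, ∃ x ∈ f i, x ∈ R

/-- A `K_k`-minor of `G` with branch sets inside `S`. -/
def KMinor (G : SimpleGraph V) (k : ℕ) (S : Finset V) : Prop := RootedKMinor G k S S

lemma RootedKMinor.kMinor (h : RootedKMinor G k S R) : KMinor G k S := by
  obtain ⟨f, h1, h2, h3, h4, -⟩ := h
  exact ⟨f, h1, h2, h3, h4, fun i => let ⟨x, hx⟩ := (h2 i).1; ⟨x, hx, h1 i hx⟩⟩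

lemma KMinor.mono (h : KMinor G k S) (hST : S ⊆ T) : KMinor G k T := by
  obtain ⟨f, h1, h2, h3, h4, h5⟩ := h
  exact ⟨f, fun i => (h1 i).trans hST, h2, h3, h4,
    fun i => let ⟨x, hx, hxS⟩ := h5 i; ⟨x, hx, hST hxS⟩⟩

lemma KMinor.of_le (h : KMinor G k S) (hG : G ≤ G') : KMinor G' k S := by
  obtain ⟨f, h1, h2, h3, h4, h5⟩ := h
  refine ⟨f, h1, fun i => ⟨(h2 i).1, fun x hx y hy => ?_⟩, h3, fun i j hij => ?_, h5⟩
  · exact ReflTransGen.mono (fun _ _ h => ⟨hG h.1, h.2⟩) _ _ ((h2 i).2 x hx y hy)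
  · obtain ⟨x, hx, y, hy, hxy⟩ := h4 i j hij
    exact ⟨x, hx, y, hy, hG hxy⟩

lemma RootedKMinor.cone (h : RootedKMinor G k S R) (hC : ConnOn G C) (hCS : Disjoint C S)
    (hadj : ∀ r ∈ R, r ∈ S → ∃ c ∈ C, G.Adj r c) (hCR : ∃ c ∈ C, c ∈ R') (hR : R ⊆ R') :
    RootedKMinor G (k + 1) (S ∪ C) R' := by
  obtain ⟨f, h1, h2, h3, h4, h5⟩ := h
  have hd : ∀ i, Disjoint C (f i) := fun i => hCS.mono_right (h1 i)
  have ha : ∀ i, ∃ x ∈ f i, ∃ c ∈ C, G.Adj x c := fun i =>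
    let ⟨x, hx, hxR⟩ := h5 i; ⟨x, hx, hadj x hxR (h1 i hx)⟩
  refine ⟨Fin.cons C f, ?_, ?_, ?_, ?_, ?_⟩
  · intro i
    refine Fin.cases ?_ (fun i => ?_) i
    · simp
    · simpa using (h1 i).trans subset_union_left
  · intro i
    refine Fin.cases ?_ (fun i => ?_) i
    · simpa using hC
    · simpa using h2 i
  · intro i j
    refine Fin.cases ?_ (fun i => ?_) i <;> refine Fin.cases ?_ (fun j => ?_) j
    · simp
    · intro _; simpa using hd j
    · intro _; simpa using (hd i).symm
    · intro hij; simpa using h3 i j (by simpa using hij)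
  · intro i j
    refine Fin.cases ?_ (fun i => ?_) i <;> refine Fin.cases ?_ (fun j => ?_) j
    · simp
    · intro _
      obtain ⟨x, hx, c, hc, hxc⟩ := ha j
      exact ⟨c, by simpa using hc, x, by simpa using hx, hxc.symm⟩
    · intro _
      obtain ⟨x, hx, c, hc, hxc⟩ := ha i
      exact ⟨x, by simpa using hx, c, by simpa using hc, hxc⟩
    · intro hij; simpa using h4 i j (by simpa using hij)
  · intro i
    refine Fin.cases ?_ (fun i => ?_) i
    · simpa using hCR
    · obtain ⟨x, hx, hxR⟩ := h5 i
      exact ⟨x, by simpa using hx, hR hxR⟩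

lemma KMinor.cone (h : KMinor G k S) (hC : ConnOn G C) (hCS : Disjoint C S)
    (hadj : ∀ s ∈ S, ∃ c ∈ C, G.Adj s c) : KMinor G (k + 1) (S ∪ C) :=
  RootedKMinor.cone h hC hCS (fun r hr _ => hadj r hr)
    (let ⟨c, hc⟩ := hC.1; ⟨c, hc, mem_union_right _ hc⟩) subset_union_left

lemma kMinor_of_isClique (h : G.IsClique (B : Set V)) (hk : k ≤ #B) : KMinor G k B := by
  obtain ⟨B', hB', hc⟩ := exists_subset_card_eq hk
  let e := B'.equivFinOfCardEq hc
  have he : ∀ i, (e.symm i : V) ∈ B := fun i => hB' (e.symm i).2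
  have hne : ∀ i j, i ≠ j → (e.symm i : V) ≠ e.symm j := fun i j hij h =>
    hij (e.symm.injective (Subtype.ext h))
  refine ⟨fun i => {(e.symm i : V)}, fun i => by simpa using he i,
    fun i => connOn_singleton _, fun i j hij => disjoint_singleton.2 (hne i j hij),
    fun i j hij => ?_, fun i => ⟨_, mem_singleton_self _, he i⟩⟩
  exact ⟨_, mem_singleton_self _, _, mem_singleton_self _, h (he i) (he j) (hne i j hij)⟩

lemma KMinor.minorOf (h : KMinor G k S) : (⊤ : SimpleGraph (Fin k)).MinorOf G := by
  obtain ⟨f, -, h2, h3, h4, -⟩ := h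
  refine ⟨fun i => f i, fun i => (h2 i).1, fun i => (h2 i).induce_connected,
    fun i j hij => by simpa using h3 i j hij, fun i j hij => ?_⟩
  obtain ⟨x, hx, y, hy, hxy⟩ := h4 i j (by simpa using hij)
  exact ⟨x, hx, y, hy, hxy⟩

/-! ### Contractions -/

/-- The graph obtained from `G` by joining `u` to all neighbors of `C`. Restricted to the
complement of `C`, this is the contraction of `C ∪ {u}` onto `u`. -/
def contr (G : SimpleGraph V) (u : V) (C : Finset V) : SimpleGraph V where
  Adj x y := x ≠ y ∧
    (G.Adj x y ∨ (x = u ∧ ∃ c ∈ C, G.Adj c y) ∨ (y = u ∧ ∃ c ∈ C, G.Adj c x))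
  symm := ⟨fun x y h => ⟨h.1.symm, by
    rcases h.2 with h | h | h
    · exact Or.inl h.symm
    · exact Or.inr (Or.inr h)
    · exact Or.inr (Or.inl h)⟩⟩
  loopless := ⟨fun x h => h.1 rfl⟩

lemma KMinor.of_contr (h : KMinor (contr G u C) k S) (hC : ConnOn G (insert u C))
    (hCS : Disjoint C S) : KMinor G k (S ∪ C) := by
  obtain ⟨f, h1, h2, h3, h4, -⟩ := h
  let g : Fin k → Finset V := fun i => if u ∈ f i then f i ∪ C else f i
  have hfg : ∀ i, f i ⊆ g i := fun i => by
    by_cases hi : u ∈ f i <;> simp [g, hi, subset_union_left]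
  have hg : ∀ i, g i ⊆ f i ∪ C := fun i => by
    by_cases hi : u ∈ f i <;> simp [g, hi, subset_union_left]
  have hug : ∀ i, u ∈ f i → C ⊆ g i := fun i hi => by simp [g, hi, subset_union_right]
  have hju : ∀ i, u ∈ f i → ∀ c ∈ C, Joined G (g i) u c := fun i hi c hc =>
    (hC.2 u (mem_insert_self _ _) c (mem_insert_of_mem hc)).mono
      (insert_subset (hfg i hi) (hug i hi))
  have hj : ∀ i x y, Joined (contr G u C) (f i) x y → Joined G (g i) x y := by
    intro i x y hxy
    induction hxy with
    | refl => exact ReflTransGen.refl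
    | @tail a b _ hab ih =>
      refine ih.trans ?_
      obtain ⟨⟨_, hab⟩, ha, hb⟩ := hab
      rcases hab with hab | ⟨rfl, c, hc, hcb⟩ | ⟨rfl, c, hc, hca⟩
      · exact Joined.of_adj hab (hfg i ha) (hfg i hb)
      · exact (hju i ha c hc).tail ⟨hcb, hug i ha hc, hfg i hb⟩
      · exact Joined.symm ((hju i hb c hc).tail ⟨hca, hug i hb hc, hfg i ha⟩)
  have hconn : ∀ i, ConnOn G (g i) := by
    intro i
    obtain ⟨a, ha⟩ := (h2 i).1
    refine ⟨⟨a, hfg i ha⟩, ?_⟩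
    have key : ∀ z ∈ g i, Joined G (g i) a z := by
      intro z hz
      by_cases hzf : z ∈ f i
      · exact hj i a z ((h2 i).2 a ha z hzf)
      · have hzC : z ∈ C := (mem_union.1 (hg i hz)).resolve_left hzf
        have hui : u ∈ f i := by
          by_contra hui
          simp only [g, hui, if_false] at hz
          exact hzf hz
        exact (hj i a u ((h2 i).2 a ha u hui)).trans (hju i hui z hzC)
    exact fun p hp q hq => (key p hp).symm.trans (key q hq)
  refine RootedKMinor.kMinor (R := S ∪ C) ⟨g, fun i => (hg i).trans ?_, hconn, ?_, ?_, ?_⟩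
  · exact union_subset_union_left (h1 i)
  · intro i j hij
    have hd := h3 i j hij
    rw [Finset.disjoint_left] at hd ⊢
    intro z hzi hzj
    have hCf : ∀ i, z ∈ C → z ∉ f i := fun i hz hzf => (Finset.disjoint_left.1 hCS) hz (h1 i hzf)
    by_cases hi : u ∈ f i <;> by_cases hj : u ∈ f j
    · exact hd hi hj
    all_goals simp only [g, hi, hj, if_true, if_false, mem_union] at hzi hzj
    · rcases hzi with hzi | hzi
      · exact hd hzi hzj
      · exact hCf j hzi hzj
    · rcases hzj with hzj | hzj
      · exact hd hzi hzj
      · exact hCf i hzj hzi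
    · exact hd hzi hzj
  · intro i j hij
    obtain ⟨x, hx, y, hy, -, hxy⟩ := h4 i j hij
    rcases hxy with hxy | ⟨rfl, c, hc, hcy⟩ | ⟨rfl, c, hc, hcx⟩
    · exact ⟨x, hfg i hx, y, hfg j hy, hxy⟩
    · exact ⟨c, hug i hx hc, y, hfg j hy, hcy⟩
    · exact ⟨x, hfg i hx, c, hug j hy hc, hcx.symm⟩
  · intro i
    obtain ⟨x, hx⟩ := (h2 i).1
    exact ⟨x, hfg i hx, mem_union_left _ (h1 i hx)⟩

/-! ### Counting edges inside a vertex set -/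

/-- The neighbors of `x` inside `A`. -/
noncomputable def nbhd (G : SimpleGraph V) (A : Finset V) (x : V) : Finset V := {y ∈ A | G.Adj x y}

/-- The sum of the degrees in the subgraph induced by `A`, that is, twice its number of edges. -/
noncomputable def dsum (G : SimpleGraph V) (A : Finset V) : ℕ := ∑ x ∈ A, #(nbhd G A x)

lemma mem_nbhd : y ∈ nbhd G A x ↔ y ∈ A ∧ G.Adj x y := mem_filter

lemma nbhd_subset : nbhd G A x ⊆ A := filter_subset _ _

lemma notMem_nbhd_self : x ∉ nbhd G A x := fun h => G.loopless.irrefl x (mem_nbhd.1 h).2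

lemma nbhd_mono (h : A ⊆ B) : nbhd G A x ⊆ nbhd G B x := filter_subset_filter _ h

lemma nbhd_subset_erase : nbhd G A x ⊆ A.erase x := fun _ hy =>
  mem_erase.2 ⟨fun h => notMem_nbhd_self (h ▸ hy), nbhd_subset hy⟩

lemma nbhd_nbhd : nbhd G (nbhd G A x) y = nbhd G A x ∩ nbhd G A y := by
  ext z; simp only [mem_nbhd, mem_inter]; tauto

lemma card_nbhd_insert (hx : x ∉ A) (y : V) :
    #(nbhd G (insert x A) y) = #(nbhd G A y) + if G.Adj y x then 1 else 0 := by
  unfold nbhd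
  rw [filter_insert]
  split_ifs with h
  · rw [card_insert_of_notMem (by simp [hx])]
  · simp

lemma dsum_insert (hx : x ∉ A) : dsum G (insert x A) = dsum G A + 2 * #(nbhd G A x) := by
  unfold dsum
  rw [sum_insert hx, card_nbhd_insert hx, sum_congr rfl fun y _ => card_nbhd_insert hx y,
    sum_add_distrib, ← card_filter]
  have : #{y ∈ A | G.Adj y x} = #(nbhd G A x) := by
    unfold nbhd; congr 1; ext y; simp [G.adj_comm]
  simp only [SimpleGraph.irrefl, if_false]
  lia

lemma nbhd_erase_self : nbhd G (A.erase x) x = nbhd G A x := by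
  ext y; simp only [mem_nbhd, mem_erase]
  exact ⟨fun h => ⟨h.1.2, h.2⟩, fun h => ⟨⟨h.2.ne', h.1⟩, h.2⟩⟩

lemma dsum_erase (hx : x ∈ A) : dsum G A = dsum G (A.erase x) + 2 * #(nbhd G A x) := by
  conv_lhs => rw [← insert_erase hx]
  rw [dsum_insert (notMem_erase x A), nbhd_erase_self]

lemma even_dsum (G : SimpleGraph V) (A : Finset V) : Even (dsum G A) := by
  induction A using Finset.induction_on with
  | empty => simp [dsum]
  | insert x A hx ih => rw [dsum_insert hx]; exact ih.add (even_two_mul _)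

lemma dsum_mono (h : ∀ x ∈ A, ∀ y ∈ A, G.Adj x y → G'.Adj x y) : dsum G A ≤ dsum G' A :=
  sum_le_sum fun x hx => card_le_card fun y hy => by
    rw [mem_nbhd] at *; exact ⟨hy.1, h x hx y hy.1 hy.2⟩

lemma dsum_le_contr (hu : u ∈ A) (hv : v ∈ A) (h : G.Adj u v) :
    dsum G A ≤ dsum (contr G u {v}) (A.erase v) + 2 + 2 * #(nbhd G A u ∩ nbhd G A v) := by
  have hu' : u ∈ A.erase v := mem_erase.2 ⟨h.ne, hu⟩
  rw [dsum_erase hv, dsum_erase hu', dsum_erase hu' (G := contr G u {v})]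
  have h1 : dsum G ((A.erase v).erase u) ≤ dsum (contr G u {v}) ((A.erase v).erase u) :=
    dsum_mono fun x _ y _ hxy => ⟨hxy.ne, Or.inl hxy⟩
  have h2 : nbhd G (A.erase v) u ∪ (nbhd G A v).erase u ⊆ nbhd (contr G u {v}) (A.erase v) u := by
    intro x hx
    rw [mem_union, mem_erase, mem_nbhd, mem_nbhd] at hx
    rw [mem_nbhd, mem_erase]
    rcases hx with ⟨hx, hux⟩ | ⟨hxu, hxA, hvx⟩
    · exact ⟨mem_erase.1 hx, hux.ne, Or.inl hux⟩
    · exact ⟨⟨hvx.ne', hxA⟩, hxu.symm, Or.inr (Or.inl ⟨rfl, v, mem_singleton_self v, hvx⟩)⟩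
  have h3 : nbhd G (A.erase v) u ∩ (nbhd G A v).erase u ⊆ nbhd G A u ∩ nbhd G A v :=
    inter_subset_inter (nbhd_mono (erase_subset _ _)) (erase_subset _ _)
  have h4 := card_union_add_card_inter (nbhd G (A.erase v) u) ((nbhd G A v).erase u)
  have h5 := card_erase_add_one (mem_nbhd.2 ⟨hu, h.symm⟩ : u ∈ nbhd G A v)
  have h6 := card_le_card h2
  have h7 := card_le_card h3
  lia

lemma dsum_le_deleteEdges (hx : x ∈ A) :
    dsum G A ≤ dsum (G.deleteEdges {s(x, y)}) A + 2 := by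
  rw [dsum_erase hx, dsum_erase hx (G := G.deleteEdges {s(x, y)})]
  have h1 : dsum G (A.erase x) ≤ dsum (G.deleteEdges {s(x, y)}) (A.erase x) :=
    dsum_mono fun a ha b hb hab => by
      rw [deleteEdges_adj]
      refine ⟨hab, fun h => ?_⟩
      rw [Set.mem_singleton_iff, Sym2.eq_iff] at h
      rcases h with h | h
      · exact (mem_erase.1 ha).1 h.1
      · exact (mem_erase.1 hb).1 h.2
  have h2 : nbhd G A x ⊆ insert y (nbhd (G.deleteEdges {s(x, y)}) A x) := by
    intro z hz
    rw [mem_nbhd] at hz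
    rw [mem_insert, mem_nbhd, deleteEdges_adj]
    by_cases hzy : z = y
    · exact Or.inl hzy
    · refine Or.inr ⟨hz.1, hz.2, fun h => ?_⟩
      rw [Set.mem_singleton_iff, Sym2.eq_iff] at h
      rcases h with h | h
      · exact hzy h.2
      · exact hz.2.ne h.2.symm
  have h3 := (card_le_card h2).trans (card_insert_le _ _)
  lia

lemma dsum_le_mul_pred (G : SimpleGraph V) (A : Finset V) : dsum G A ≤ #A * (#A - 1) := by
  rw [← smul_eq_mul]
  exact sum_le_card_nsmul _ _ _ fun x hx =>
    (card_le_card nbhd_subset_erase).trans (card_erase_of_mem hx).le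

lemma mul_card_le_dsum (h : ∀ x ∈ A, n ≤ #(nbhd G A x)) : #A * n ≤ dsum G A := by
  rw [← smul_eq_mul]; exact card_nsmul_le_sum _ _ _ h

lemma KMinor.of_nbhd (h : KMinor G k (nbhd G A x)) (hx : x ∈ A) : KMinor G (k + 1) A := by
  refine (h.cone (connOn_singleton x) ?_ fun s hs =>
    ⟨x, mem_singleton_self x, (mem_nbhd.1 hs).2.symm⟩).mono ?_
  · simpa using notMem_nbhd_self
  · exact union_subset nbhd_subset (by simpa using hx)

lemma KMinor.of_contr_erase (h : KMinor (contr G u {v}) k (A.erase v)) (hv : v ∈ A)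
    (huv : G.Adj u v) : KMinor G k A := by
  have hc : ConnOn G (insert u {v}) := by
    rw [insert_eq]
    exact (connOn_singleton u).union (connOn_singleton v) (mem_singleton_self u)
      (mem_singleton_self v) (Or.inr huv)
  refine (h.of_contr hc (by simp)).mono ?_
  exact union_subset (erase_subset _ _) (by simpa using hv)

/-- A minor-minimal graph without `K_k`-minor having at least `a n - c` edges. -/
theorem exists_minimal {a c n₀ : ℕ} (hb : n₀ * (n₀ - 1) + 2 * c < 2 * a * n₀)
    (h : ∃ (G : SimpleGraph V) (A : Finset V),
      ¬ KMinor G k A ∧ n₀ ≤ #A ∧ 2 * a * #A ≤ dsum G A + 2 * c) :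
    ∃ (G : SimpleGraph V) (A : Finset V), ¬ KMinor G k A ∧ n₀ < #A ∧
      dsum G A + 2 * c ≤ 2 * a * #A + 1 ∧
      (∀ u ∈ A, ∀ v ∈ A, G.Adj u v → a ≤ #(nbhd G A u ∩ nbhd G A v)) ∧
      (∀ x ∈ A, a < #(nbhd G A x)) ∧
      ∀ (G' : SimpleGraph V) (A' : Finset V), #A' < #A → n₀ ≤ #A' → ¬ KMinor G' k A' →
        dsum G' A' + 2 * c < 2 * a * #A' := by
  obtain ⟨G₀, A₀, h₀⟩ := h
  obtain ⟨⟨G, A⟩, ⟨hk, hn, hd⟩, hmin⟩ := WellFounded.has_min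
    (InvImage.wf (fun p : SimpleGraph V × Finset V => toLex (#p.2, dsum p.1 p.2)) wellFounded_lt)
    {p | ¬ KMinor p.1 k p.2 ∧ n₀ ≤ #p.2 ∧ 2 * a * #p.2 ≤ dsum p.1 p.2 + 2 * c} ⟨(G₀, A₀), h₀⟩
  dsimp only at hk hn hd
  have hmin1 : ∀ (G' : SimpleGraph V) (A' : Finset V), #A' < #A → n₀ ≤ #A' → ¬ KMinor G' k A' →
      dsum G' A' + 2 * c < 2 * a * #A' := by
    intro G' A' h1 h2 h3
    by_contra h4
    exact hmin (G', A') ⟨h3, h2, not_lt.1 h4⟩ (Prod.Lex.toLex_lt_toLex.2 (Or.inl h1))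
  have hn' : n₀ < #A := by
    refine lt_of_le_of_ne hn fun hne => ?_
    have := dsum_le_mul_pred G A
    rw [← hne] at this hd
    lia
  refine ⟨G, A, hk, hn', ?_, ?_, ?_, hmin1⟩
  · by_contra hlt
    have hpos : 0 < dsum G A := by
      by_contra h0
      have h1 : n₀ * (2 * a) + (#A - n₀) * (2 * a) = #A * (2 * a) := by
        rw [← add_mul]; congr 1; lia
      have h2 : 2 * a * n₀ ≤ 2 * a * #A := Nat.mul_le_mul_left _ hn
      lia
    obtain ⟨x, hx, hxd⟩ := exists_ne_zero_of_sum_ne_zero hpos.ne'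
    obtain ⟨y, hy⟩ := card_ne_zero.1 hxd
    have hle : G.deleteEdges {s(x, y)} ≤ G := deleteEdges_le _
    have h1 := dsum_le_deleteEdges (G := G) (y := y) hx
    have h2 : dsum (G.deleteEdges {s(x, y)}) A < dsum G A := by
      refine sum_lt_sum (fun z _ => card_le_card fun w hw => ?_) ⟨x, hx, card_lt_card ?_⟩
      · rw [mem_nbhd] at *; exact ⟨hw.1, hle hw.2⟩
      · refine ⟨fun w hw => ?_, fun hsub => ?_⟩
        · rw [mem_nbhd] at *; exact ⟨hw.1, hle hw.2⟩
        · have := hsub hy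
          rw [mem_nbhd, deleteEdges_adj] at this
          exact this.2.2 rfl
    refine hmin (G.deleteEdges {s(x, y)}, A) ⟨fun h => hk (h.of_le hle), hn, ?_⟩
      (Prod.Lex.toLex_lt_toLex.2 (Or.inr ⟨rfl, h2⟩))
    dsimp only
    lia
  · intro u hu v hv huv
    by_contra hlt
    have h1 := dsum_le_contr hu hv huv
    have h2 := card_erase_add_one hv
    have h3 := hmin1 (contr G u {v}) (A.erase v) (by lia) (by lia)
      fun h => hk (h.of_contr_erase hv huv)
    rw [← h2] at hd
    lia
  · intro x hx
    by_contra hlt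
    have h1 := dsum_erase (G := G) hx
    have h2 := card_erase_add_one hx
    have h3 := hmin1 G (A.erase x) (by lia) (by lia) fun h => hk (h.mono (erase_subset _ _))
    rw [← h2] at hd
    lia

/-! ### Edge bounds for small complete minors -/

theorem kMinor_three (h2 : 2 ≤ #A) (hd : 2 * #A ≤ dsum G A) : KMinor G 3 A := by
  by_contra hk
  obtain ⟨G, A, hk, hn, -, hc, hx, -⟩ := exists_minimal (a := 1) (c := 0) (n₀ := 2) (k := 3)
    (by norm_num) ⟨G, A, hk, h2, by lia⟩
  obtain ⟨x, hxA⟩ : A.Nonempty := card_pos.1 (by lia)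
  obtain ⟨y, hy⟩ := card_pos.1 (show 0 < #(nbhd G A x) by have := hx x hxA; lia)
  obtain ⟨z, hz⟩ := card_pos.1 (hc x hxA y (nbhd_subset hy) (mem_nbhd.1 hy).2)
  rw [mem_inter, mem_nbhd, mem_nbhd] at hz
  rw [mem_nbhd] at hy
  have hxy := hy.2
  have hxz := hz.1.2
  have hyz := hz.2.2
  refine hk ((kMinor_of_isClique (B := {x, y, z}) ?_ ?_).mono ?_)
  · simp [isClique_insert, hxy, hxz, hyz]
  · rw [card_eq_three.2 ⟨x, y, z, hxy.ne, hxz.ne, hyz.ne, rfl⟩]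
  · simp [insert_subset_iff, hxA, hy.1, hz.1.1]

theorem kMinor_four (h3 : 3 ≤ #A) (hd : 4 * #A ≤ dsum G A + 4) : KMinor G 4 A := by
  by_contra hk
  obtain ⟨G, A, hk, hn, -, hc, hx, -⟩ := exists_minimal (a := 2) (c := 2) (n₀ := 3) (k := 4)
    (by norm_num) ⟨G, A, hk, h3, by lia⟩
  obtain ⟨x, hxA⟩ : A.Nonempty := card_pos.1 (by lia)
  have hxd := hx x hxA
  refine hk (KMinor.of_nbhd (x := x) (kMinor_three (by lia) ?_) hxA)
  have := mul_card_le_dsum (G := G) (A := nbhd G A x) (n := 2) fun y hy => by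
    rw [nbhd_nbhd]; exact hc x hxA y (nbhd_subset hy) (mem_nbhd.1 hy).2
  lia

theorem kMinor_five (h4 : 4 ≤ #A) (hd : 6 * #A ≤ dsum G A + 10) : KMinor G 5 A := by
  by_contra hk
  obtain ⟨G, A, hk, hn, hle, hc, hx, -⟩ := exists_minimal (a := 3) (c := 5) (n₀ := 4) (k := 5)
    (by norm_num) ⟨G, A, hk, h4, by lia⟩
  obtain ⟨x, hxA, hx5⟩ : ∃ x ∈ A, #(nbhd G A x) < 6 := by
    by_contra! hcon
    have := mul_card_le_dsum hcon
    lia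
  have hxd := hx x hxA
  refine hk (KMinor.of_nbhd (x := x) (kMinor_four (by lia) ?_) hxA)
  have := mul_card_le_dsum (G := G) (A := nbhd G A x) (n := 3) fun y hy => by
    rw [nbhd_nbhd]; exact hc x hxA y (nbhd_subset hy) (mem_nbhd.1 hy).2
  have he := even_dsum G (nbhd G A x)
  obtain ⟨r, hr⟩ := he
  lia

/-! ### Neighborhoods of minimum degree five -/

lemma nbhd_erase_of_not_adj (h : ¬ G.Adj w u) : nbhd G (A.erase u) w = nbhd G A w := by
  ext y; simp only [mem_nbhd, mem_erase]
  exact ⟨fun h => ⟨h.1.2, h.2⟩, fun hy => ⟨⟨fun hyu => h (hyu ▸ hy.2), hy.1⟩, hy.2⟩⟩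

lemma exists_not_adj_of_card_nbhd_lt (h : #(nbhd G A x) + 1 < #A) :
    ∃ y ∈ A, y ≠ x ∧ ¬ G.Adj x y := by
  by_contra! hcon
  have : A ⊆ insert x (nbhd G A x) := fun y hy => by
    rw [mem_insert, mem_nbhd]
    by_cases hyx : y = x
    · exact Or.inl hyx
    · exact Or.inr ⟨hy, hcon y hy hyx⟩
  have := (card_le_card this).trans (card_insert_le _ _)
  lia

lemma card_nbhd_lt_of_not_adj (hx : x ∈ A) (hy : y ∈ A) (hyx : y ≠ x) (h : ¬ G.Adj x y) :
    #(nbhd G A x) + 1 < #A := by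
  have h1 : nbhd G A x ⊆ (A.erase x).erase y := fun z hz =>
    mem_erase.2 ⟨fun hzy => h (hzy ▸ (mem_nbhd.1 hz).2), nbhd_subset_erase hz⟩
  have h2 := card_le_card h1
  have h3 := card_erase_add_one (mem_erase.2 ⟨hyx, hy⟩)
  have h4 := card_erase_add_one hx
  lia

lemma dsum_sdiff_le (hT : T ⊆ A) (h : ∀ w ∈ T, n ≤ #(nbhd G A w)) :
    dsum G (A \ T) + 2 * n * #T ≤ dsum G A + #T * (#T - 1) := by
  induction T using Finset.induction_on with
  | empty => simp
  | insert w T hw ih =>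
    have ih := ih ((subset_insert _ _).trans hT) fun x hx => h x (mem_insert_of_mem hx)
    have hwA : w ∈ A \ T := mem_sdiff.2 ⟨hT (mem_insert_self _ _), hw⟩
    have h1 := dsum_erase (G := G) hwA
    have h2 : nbhd G A w ⊆ nbhd G (A \ T) w ∪ T := fun y hy => by
      rw [mem_union, mem_nbhd, mem_sdiff]
      rw [mem_nbhd] at hy
      tauto
    have h3 := (card_le_card h2).trans (card_union_le _ _)
    have h4 := h w (mem_insert_self _ _)
    have h0 : A \ insert w T = (A \ T).erase w := by ext; simp; tauto
    rw [← h0] at h1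
    rw [card_insert_of_notMem hw, Nat.add_sub_cancel]
    have h5 : (#T + 1) * #T = #T * (#T - 1) + 2 * #T := by
      rcases #T with _ | t
      · rfl
      · rw [Nat.add_sub_cancel]; ring
    have h6 : 2 * n * (#T + 1) = 2 * n * #T + 2 * n := by ring
    lia

lemma isClique_or_exists_not_adj (G : SimpleGraph V) (A : Finset V) :
    G.IsClique (A : Set V) ∨ ∃ p ∈ A, ∃ q ∈ A, q ≠ p ∧ ¬ G.Adj p q := by
  by_contra! hcon
  exact hcon.1 fun p hp q hq hpq => hcon.2 p hp q hq hpq.symm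

lemma exists_card_nbhd_inter_le_two (h8 : 8 ≤ #A) (h9 : #A ≤ 9)
    (hd : dsum G A ≤ 5 * #A + 1) (hδ : ∀ x ∈ A, 5 ≤ #(nbhd G A x)) (hu : u ∈ A)
    (hu5 : #(nbhd G A u) = 5) :
    ∃ v ∈ nbhd G A u, #(nbhd G A u ∩ nbhd G A v) ≤ 2 := by
  by_contra! hcon
  have h1 := dsum_erase (G := G) hu
  have h2 := dsum_sdiff_le (G := G) (A := A.erase u) (T := A.erase u \ nbhd G A u) (n := 5)
    sdiff_subset fun w hw => by
      rw [mem_sdiff, mem_erase, mem_nbhd] at hw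
      rw [nbhd_erase_of_not_adj fun h => hw.2 ⟨hw.1.2, h.symm⟩]
      exact hδ w hw.1.2
  rw [Finset.sdiff_sdiff_eq_self nbhd_subset_erase] at h2
  have h3 : #(A.erase u \ nbhd G A u) = #A - 6 := by
    rw [card_sdiff_of_subset nbhd_subset_erase, card_erase_of_mem hu]; lia
  have h4 := mul_card_le_dsum (G := G) (A := nbhd G A u) (n := 3) fun v hv => by
    rw [nbhd_nbhd]; exact hcon v hv
  rw [h3] at h2
  obtain ⟨r, hr⟩ := even_dsum G A
  obtain h | h : #A = 8 ∨ #A = 9 := by lia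
  all_goals rw [h] at h2 hd; norm_num at h2 hd; lia

theorem exists_kMinor_five_erase (h6 : 6 ≤ #A) (h9 : #A ≤ 9)
    (hδ : ∀ x ∈ A, 5 ≤ #(nbhd G A x)) (hA : ¬ G.IsClique (A : Set V)) :
    ∃ m ∈ A, (∃ w ∈ A, w ≠ m ∧ ¬ G.Adj m w) ∧ KMinor G 5 (A.erase m) := by
  obtain ⟨p, hp, q, hq, hqp, hpq⟩ := (isClique_or_exists_not_adj G A).resolve_left hA
  obtain ⟨u, hu, hmin⟩ := exists_min_image A (fun x => #(nbhd G A x)) ⟨p, hp⟩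
  have hpd := card_nbhd_lt_of_not_adj hp hq hqp hpq
  have hup := hmin p hp
  have hD := mul_card_le_dsum hmin
  have hDu := dsum_erase (G := G) hu
  have hcu := card_erase_add_one hu
  have hu5 := hδ u hu
  by_cases hbig : 6 * #(A.erase u) ≤ dsum G (A.erase u) + 10
  · exact ⟨u, hu, exists_not_adj_of_card_nbhd_lt (by lia), kMinor_five (by lia) hbig⟩
  obtain ⟨r, hr⟩ := even_dsum G A
  have key : 8 ≤ #A ∧ #(nbhd G A u) = 5 ∧ dsum G A ≤ 5 * #A + 1 ∧ 6 * #A ≤ dsum G A + 8 := by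
    obtain h | h | h | h : #A = 6 ∨ #A = 7 ∨ #A = 8 ∨ #A = 9 := by lia
    all_goals rw [h] at hD; refine ⟨?_, ?_, ?_, ?_⟩ <;> lia
  obtain ⟨h8, hu5, hDle, hDge⟩ := key
  obtain ⟨v, hv, hcom⟩ := exists_card_nbhd_inter_le_two h8 h9 hDle hδ hu hu5
  have hvA := nbhd_subset hv
  have huv := (mem_nbhd.1 hv).2
  have hY : #{w ∈ A | #(nbhd G A w) ≠ 5} ≤ 1 := by
    have h1 : ∑ w ∈ A, (5 + if #(nbhd G A w) ≠ 5 then 1 else 0) ≤ dsum G A :=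
      sum_le_sum fun w hw => by
        have := hδ w hw
        split_ifs <;> lia
    rw [sum_add_distrib, ← card_filter, sum_const, smul_eq_mul] at h1
    lia
  have hm : ∃ m ∈ A, m ≠ u ∧ m ≠ v ∧ #(nbhd G A m) = 5 ∧
      #((nbhd G A u ∩ nbhd G A v).erase m) ≤ 1 := by
    by_cases h1 : #(nbhd G A u ∩ nbhd G A v) ≤ 1
    · have h2 := card_erase_add_one (mem_erase.2 ⟨huv.ne', hvA⟩)
      obtain ⟨m, hm⟩ : (((A.erase u).erase v) \ {w ∈ A | #(nbhd G A w) ≠ 5}).Nonempty := by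
        refine card_pos.1 ?_
        have := le_card_sdiff {w ∈ A | #(nbhd G A w) ≠ 5} ((A.erase u).erase v)
        lia
      simp only [mem_sdiff, mem_erase, mem_filter, not_and, not_not] at hm
      exact ⟨m, hm.1.2.2, hm.1.2.1, hm.1.1, hm.2 hm.1.2.2,
        (card_le_card (erase_subset _ _)).trans h1⟩
    · obtain ⟨m, hm⟩ : ((nbhd G A u ∩ nbhd G A v) \ {w ∈ A | #(nbhd G A w) ≠ 5}).Nonempty := by
        refine card_pos.1 ?_
        have := le_card_sdiff {w ∈ A | #(nbhd G A w) ≠ 5} (nbhd G A u ∩ nbhd G A v)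
        lia
      simp only [mem_sdiff, mem_filter, not_and, not_not] at hm
      have hmuv := mem_inter.1 hm.1
      have h2 := card_erase_add_one hm.1
      exact ⟨m, nbhd_subset hmuv.1, (mem_nbhd.1 hmuv.1).2.ne', (mem_nbhd.1 hmuv.2).2.ne',
        hm.2 (nbhd_subset hmuv.1), by lia⟩
  obtain ⟨m, hmA, hmu, hmv, hm5, hmc⟩ := hm
  have hu' : u ∈ A.erase m := mem_erase.2 ⟨hmu.symm, hu⟩
  have hv' : v ∈ A.erase m := mem_erase.2 ⟨hmv.symm, hvA⟩
  have h1 := dsum_le_contr hu' hv' huv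
  have h2 : nbhd G (A.erase m) u ∩ nbhd G (A.erase m) v ⊆ (nbhd G A u ∩ nbhd G A v).erase m := by
    intro w hw
    simp only [mem_inter, mem_nbhd, mem_erase] at *
    tauto
  have h3 := card_le_card h2
  have h4 := dsum_erase (G := G) hmA
  have h5 := card_erase_add_one hmA
  have h6 := card_erase_add_one hv'
  exact ⟨m, hmA, exists_not_adj_of_card_nbhd_lt (by lia),
    (kMinor_five (by lia) (by lia)).of_contr_erase hv' huv⟩

lemma KMinor.seven_of_five (h : KMinor G 5 T) (hx : x ∈ A) (hT : T ⊆ nbhd G A x)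
    (hC : ConnOn G C) (hCA : C ⊆ A) (hxC : x ∉ C) (hCT : Disjoint C T) (hxc : ∃ c ∈ C, G.Adj x c)
    (hTC : ∀ t ∈ T, ∃ c ∈ C, G.Adj t c) : KMinor G 7 A := by
  have h6 : KMinor G 6 (T ∪ {x}) := h.cone (connOn_singleton x)
    (by simpa using fun hxT => notMem_nbhd_self (hT hxT))
    fun s hs => ⟨x, mem_singleton_self x, (mem_nbhd.1 (hT hs)).2.symm⟩
  refine (h6.cone hC ?_ ?_).mono ?_
  · rw [disjoint_union_right]
    exact ⟨hCT, by simpa using hxC⟩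
  · intro s hs
    rcases mem_union.1 hs with hs | hs
    · exact hTC s hs
    · rw [mem_singleton.1 hs]; exact hxc
  · exact union_subset (union_subset (hT.trans nbhd_subset) (by simpa using hx)) hCA

theorem kMinor_seven_of_nbhd (hx : x ∈ A) (h6 : 6 ≤ #(nbhd G A x)) (h9 : #(nbhd G A x) ≤ 9)
    (hδ : ∀ y ∈ nbhd G A x, 5 ≤ #(nbhd G (nbhd G A x) y)) (hC : ConnOn G C) (hCA : C ⊆ A)
    (hxC : x ∉ C) (hCN : Disjoint C (nbhd G A x))
    (hM : ∀ z ∈ nbhd G A x, (∃ w ∈ nbhd G A x, w ≠ z ∧ ¬ G.Adj z w) → ∃ c ∈ C, G.Adj z c) :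
    KMinor G 7 A := by
  by_cases hcl : G.IsClique (nbhd G A x : Set V)
  · exact (kMinor_of_isClique hcl h6).of_nbhd hx
  obtain ⟨m, hm, hmw, h5⟩ := exists_kMinor_five_erase h6 h9 hδ hcl
  obtain ⟨c, hc, hmc⟩ := hM m hm hmw
  have hxm := (mem_nbhd.1 hm).2
  refine h5.seven_of_five (C := C ∪ {m}) hx (erase_subset _ _)
    (hC.union (connOn_singleton m) hc (mem_singleton_self m) (Or.inr hmc.symm)) ?_ ?_ ?_ ?_ ?_
  · exact union_subset hCA (by simpa using nbhd_subset hm)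
  · simpa [hxC] using hxm.ne
  · rw [disjoint_union_left]
    exact ⟨hCN.mono_right (erase_subset _ _), by simp⟩
  · exact ⟨m, by simp, hxm⟩
  · intro t ht
    obtain ⟨htm, ht⟩ := mem_erase.1 ht
    by_cases htm' : G.Adj t m
    · exact ⟨m, by simp, htm'⟩
    · obtain ⟨c, hc, htc⟩ := hM t ht ⟨m, hm, htm.symm, htm'⟩
      exact ⟨c, mem_union_left _ hc, htc⟩

/-! ### Mader's bound for `K_7`-minors -/

/-- The vertices of `A` other than `x` that are not adjacent to `x`. -/
noncomputable def far (G : SimpleGraph V) (A : Finset V) (x : V) : Finset V :=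
  A \ insert x (nbhd G A x)

lemma mem_far : y ∈ far G A x ↔ y ∈ A ∧ y ≠ x ∧ ¬ G.Adj x y := by
  simp only [far, mem_sdiff, mem_insert, mem_nbhd]; tauto

lemma mem_comp_far_or (hz : z ∈ comp G (far G A x) w) (hy : y ∈ A) (h : G.Adj z y) :
    y ∈ comp G (far G A x) w ∨ y ∈ nbhd G A x := by
  by_cases hxy : G.Adj x y
  · exact Or.inr (mem_nbhd.2 ⟨hy, hxy⟩)
  · refine Or.inl (mem_comp_of_adj hz h (mem_far.2 ⟨hy, ?_, hxy⟩))
    rintro rfl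
    exact (mem_far.1 (comp_subset hz)).2.2 h.symm

lemma mem_comp_of_mem (hx : x ∈ comp G S z) (hy : x ∈ comp G S y) (hyS : y ∈ S) :
    y ∈ comp G S z :=
  mem_filter.2 ⟨hyS, (mem_filter.1 hx).2.trans (mem_filter.1 hy).2.symm⟩

lemma exists_card_nbhd_le_nine (hk : ¬ KMinor G 7 A)
    (hc : ∀ u ∈ A, ∀ v ∈ A, G.Adj u v → 5 ≤ #(nbhd G A u ∩ nbhd G A v))
    (hd : ∀ u ∈ A, 5 < #(nbhd G A u))
    (hmin : ∀ (G' : SimpleGraph V) (A' : Finset V), #A' < #A → 6 ≤ #A' → ¬ KMinor G' 7 A' →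
      dsum G' A' + 28 < 10 * #A')
    (hx : x ∈ A) (hx9 : #(nbhd G A x) ≤ 9) (hz : z ∈ far G A x) :
    ∃ y ∈ comp G (far G A x) z, #(nbhd G A y) ≤ 9 := by
  by_contra! hcon
  set K := comp G (far G A x) z with hK
  have hKA : K ⊆ A := fun y hy => (mem_far.1 (comp_subset hy)).1
  have hzK : z ∈ K := mem_comp_self hz
  have hxK : x ∉ K := fun h => (mem_far.1 (comp_subset h)).2.1 rfl
  let S := {s ∈ nbhd G A x | ∃ y ∈ K, G.Adj s y}
  have hSN : S ⊆ nbhd G A x := filter_subset _ _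
  have hSK : ∀ s ∈ S, ∃ y ∈ K, G.Adj s y := fun s hs => (mem_filter.1 hs).2
  have hKS : Disjoint K S := Finset.disjoint_left.2 fun y hyK hyS =>
    (mem_far.1 (comp_subset hyK)).2.2 (mem_nbhd.1 (hSN hyS)).2
  have hxS : x ∉ S := fun h => notMem_nbhd_self (hSN h)
  have hxKS : x ∉ K ∪ S := by simp [hxK, hxS]
  have hcl : ∀ y ∈ K, ∀ w ∈ A, G.Adj y w → w ∈ K ∪ S := fun y hy w hw hyw =>
    (mem_comp_far_or hy hw hyw).elim (mem_union_left _) fun h =>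
      mem_union_right _ (mem_filter.2 ⟨h, y, hy, hyw.symm⟩)
  have hNK : ∀ y ∈ K, 10 ≤ #(nbhd G (K ∪ S) y) := fun y hy =>
    (hcon y hy).trans_le (card_le_card fun w hw =>
      mem_nbhd.2 ⟨hcl y hy w (nbhd_subset hw) (mem_nbhd.1 hw).2, (mem_nbhd.1 hw).2⟩)
  have hNS : ∀ s ∈ S, 6 ≤ #(nbhd G (K ∪ S) s) := by
    intro s hs
    obtain ⟨y, hy, hsy⟩ := hSK s hs
    have h1 := hc s (nbhd_subset (hSN hs)) y (hKA hy) hsy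
    have h2 : insert y (nbhd G A s ∩ nbhd G A y) ⊆ nbhd G (K ∪ S) s := by
      intro w hw
      rw [mem_insert, mem_inter, mem_nbhd, mem_nbhd] at hw
      rcases hw with rfl | hw
      · exact mem_nbhd.2 ⟨mem_union_left _ hy, hsy⟩
      · exact mem_nbhd.2 ⟨hcl y hy w hw.1.1 hw.2.2, hw.1.2⟩
    have h3 := card_le_card h2
    rw [card_insert_of_notMem fun h => notMem_nbhd_self (mem_inter.1 h).2] at h3
    lia
  have hsum : 10 * #K + 6 * #S ≤ dsum G (K ∪ S) := by
    rw [dsum, sum_union hKS]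
    have h1 := card_nsmul_le_sum K _ 10 hNK
    have h2 := card_nsmul_le_sum S _ 6 hNS
    simp only [smul_eq_mul] at h1 h2
    lia
  have hKScard := card_union_of_disjoint hKS
  have hsub : insert x (K ∪ S) ⊆ A :=
    insert_subset hx (union_subset hKA (hSN.trans nbhd_subset))
  have hlt : #(K ∪ S) < #A := by
    have := card_le_card hsub
    rw [card_insert_of_notMem hxKS] at this
    exact this
  have hge : 6 ≤ #(K ∪ S) := by
    have h1 := hNK z hzK
    have h2 := card_le_card (nbhd_subset (G := G) (A := K ∪ S) (x := z))
    lia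
  have hKS7 := hmin G (K ∪ S) hlt hge fun h => hk (h.mono ((subset_insert _ _).trans hsub))
  have hS : ∀ s ∈ S, 14 ≤ #S + #(nbhd G S s) := by
    intro s hs
    have hsx : G.Adj s x := (mem_nbhd.1 (hSN hs)).2.symm
    have h1 : ¬ KMinor (contr G s {x}) 7 (K ∪ S) := fun h => by
      rw [← erase_insert hxKS] at h
      exact hk ((h.of_contr_erase (mem_insert_self _ _) hsx).mono hsub)
    have h2 := hmin _ _ hlt hge h1
    have h3 := dsum_le_contr (G := G) (A := insert x (K ∪ S))
      (mem_insert_of_mem (mem_union_right _ hs)) (mem_insert_self _ _) hsx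
    rw [erase_insert hxKS, dsum_insert hxKS] at h3
    have h4 : #S ≤ #(nbhd G (K ∪ S) x) := card_le_card fun t ht =>
      mem_nbhd.2 ⟨mem_union_right _ ht, (mem_nbhd.1 (hSN ht)).2⟩
    have h5 : #(nbhd G (insert x (K ∪ S)) s ∩ nbhd G (insert x (K ∪ S)) x) ≤ #(nbhd G S s) := by
      refine card_le_card fun t ht => ?_
      rw [mem_inter, mem_nbhd, mem_nbhd, mem_insert, mem_union] at ht
      refine mem_nbhd.2 ⟨?_, ht.1.2⟩
      rcases ht.1.1 with rfl | h | h
      · exact absurd ht.2.2 (G.irrefl)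
      · exact absurd ht.2.2 (mem_far.1 (comp_subset h)).2.2
      · exact h
    obtain ⟨r, hr⟩ := even_dsum (contr G s {x}) (K ∪ S)
    lia
  obtain ⟨s, hs⟩ : S.Nonempty := by
    rw [nonempty_iff_ne_empty]
    intro h
    rw [h, card_empty] at hKScard hsum
    lia
  have hS8 : 8 ≤ #S := by
    have h1 := hS s hs
    have h2 := card_le_card (nbhd_subset_erase (G := G) (A := S) (x := s))
    rw [card_erase_of_mem hs] at h2
    lia
  by_cases hSN' : S = nbhd G A x
  · refine hk (kMinor_seven_of_nbhd (C := K) hx (hd x hx) hx9 (fun y hy => ?_) (connOn_comp hz) hKA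
      hxK (hSN' ▸ hKS) fun y hy _ => hSK y (hSN' ▸ hy))
    rw [nbhd_nbhd]
    exact hc x hx y (nbhd_subset hy) (mem_nbhd.1 hy).2
  have hS8' := card_lt_card (ssubset_of_subset_of_ne hSN hSN')
  have h1 := mul_card_le_dsum (G := G) (A := S) (n := 6) fun s hs => by
    have := hS s hs
    lia
  have h2 := dsum_erase (G := G) hs
  have h3 := card_erase_add_one hs
  have h4 := card_le_card (nbhd_subset_erase (G := G) (A := S) (x := s))
  have h5 : KMinor G 5 (S.erase s) := kMinor_five (by lia) (by lia)
  obtain ⟨y, hy, hsy⟩ := hSK s hs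
  have hxs := (mem_nbhd.1 (hSN hs)).2
  refine hk (h5.seven_of_five (C := K ∪ {s}) hx ((erase_subset _ _).trans hSN)
    ((connOn_comp hz).union (connOn_singleton s) hy (mem_singleton_self s) (Or.inr hsy.symm))
    ?_ ?_ ?_ ?_ ?_)
  · exact union_subset hKA (by simpa using nbhd_subset (hSN hs))
  · simpa [hxK] using hxs.ne
  · rw [disjoint_union_left]
    exact ⟨hKS.mono_right (erase_subset _ _), by simp⟩
  · exact ⟨s, by simp, hxs⟩
  · intro t ht
    obtain ⟨y, hy, hty⟩ := hSK t (mem_of_mem_erase ht)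
    exact ⟨y, mem_union_left _ hy, hty⟩

theorem kMinor_seven (h6 : 6 ≤ #A) (hd : 10 * #A ≤ dsum G A + 28) : KMinor G 7 A := by
  by_contra hk
  obtain ⟨G, A, hk, hn, hle, hc, hdeg, hmin⟩ := exists_minimal (a := 5) (c := 14) (n₀ := 6)
    (k := 7) (by norm_num) ⟨G, A, hk, h6, by lia⟩
  simp only [Nat.reduceMul] at hle hmin
  have hδ : ∀ x ∈ A, ∀ y ∈ nbhd G A x, 5 ≤ #(nbhd G (nbhd G A x) y) := fun x hx y hy => by
    rw [nbhd_nbhd]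
    exact hc x hx y (nbhd_subset hy) (mem_nbhd.1 hy).2
  have hex : ∃ x ∈ A, #(nbhd G A x) ≤ 9 := by
    by_contra! hcon
    have := mul_card_le_dsum hcon
    lia
  have hex' : ∃ p : V × V, (p.1 ∈ A ∧ #(nbhd G A p.1) ≤ 9) ∧ p.2 ∈ far G A p.1 := by
    by_contra! hcon
    have huniv : ∀ x ∈ A, #(nbhd G A x) ≤ 9 → ∀ y ∈ A, y ≠ x → G.Adj x y := by
      intro x hx hx9 y hy hyx
      by_contra hxy
      exact hcon (x, y) ⟨hx, hx9⟩ (mem_far.2 ⟨hy, hyx, hxy⟩)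
    obtain ⟨x, hx, hx9⟩ := hex
    have h10 : #A ≤ #(nbhd G A x) + 1 := by
      by_contra! hlt
      obtain ⟨y, hy, hyx, hxy⟩ := exists_not_adj_of_card_nbhd_lt hlt
      exact hxy (huniv x hx hx9 y hy hyx)
    refine hk (kMinor_of_isClique (fun a ha b hb hab => huniv a ha ?_ b hb hab.symm) hn)
    have h1 := card_le_card (nbhd_subset_erase (G := G) (A := A) (x := a))
    rw [card_erase_of_mem ha] at h1
    lia
  obtain ⟨⟨x, z⟩, ⟨⟨hx, hx9⟩, hz⟩, hpmin⟩ := exists_minimalFor_of_wellFoundedLT _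
    (fun p : V × V => #(comp G (far G A p.1) p.2)) hex'
  dsimp only at hx hx9 hz hpmin
  obtain ⟨y₀, hy₀, hy₀9⟩ := exists_card_nbhd_le_nine hk hc hdeg hmin hx hx9 hz
  obtain ⟨y, hyK, hymin⟩ := exists_min_image (comp G (far G A x) z) (fun y => #(nbhd G A y))
    ⟨y₀, hy₀⟩
  have hy9 := (hymin y₀ hy₀).trans hy₀9
  obtain ⟨hyA, hyx, hxy⟩ := mem_far.1 (comp_subset hyK)
  have hxfar : x ∈ far G A y := mem_far.2 ⟨hx, hyx.symm, fun h => hxy h.symm⟩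
  refine hk (kMinor_seven_of_nbhd (C := comp G (far G A y) x) hyA (hdeg y hyA) hy9 (hδ y hyA)
    (connOn_comp hxfar) (fun w hw => (mem_far.1 (comp_subset hw)).1)
    (fun h => (mem_far.1 (comp_subset h)).2.1 rfl) (Finset.disjoint_left.2 fun w hw hwy =>
    (mem_far.1 (comp_subset hw)).2.2 (mem_nbhd.1 hwy).2) ?_)
  rintro v hv ⟨w, hw, hwv, hvw⟩
  by_contra! hno
  obtain ⟨hvA, hyv⟩ := mem_nbhd.1 hv
  have hvK : v ∈ comp G (far G A x) z := (mem_comp_far_or hyK hvA hyv).resolve_right fun h =>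
    hno x (mem_comp_self hxfar) (mem_nbhd.1 h).2.symm
  have hsub : nbhd G A v ⊆ ((insert y (nbhd G A y)).erase v).erase w := by
    intro p hp
    obtain ⟨hpA, hvp⟩ := mem_nbhd.1 hp
    refine mem_erase.2 ⟨fun h => hvw (h ▸ hvp), mem_erase.2 ⟨hvp.ne', ?_⟩⟩
    by_contra hpy
    have hpfar : p ∈ far G A y := by
      rw [mem_insert, mem_nbhd] at hpy
      exact mem_far.2 ⟨hpA, by tauto, by tauto⟩
    have hpL : p ∉ comp G (far G A y) x := fun h => hno p h hvp
    have hdis : ∀ q ∈ comp G (far G A y) p, q ∉ comp G (far G A y) x := fun q hq hq' =>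
      hpL (mem_comp_of_mem hq' hq hpfar)
    have hpK : p ∈ comp G (far G A x) z := (mem_comp_far_or hvK hpA hvp).resolve_right fun h =>
      hpL (mem_comp_of_adj (mem_comp_self hxfar) (mem_nbhd.1 h).2 hpfar)
    have hsubx : comp G (far G A y) p ⊆ far G A x := fun q hq =>
      mem_far.2 ⟨(mem_far.1 (comp_subset hq)).1,
        fun h => hdis q hq (by rw [h]; exact mem_comp_self hxfar),
        fun h => hdis q hq (mem_comp_of_adj (mem_comp_self hxfar) h (comp_subset hq))⟩
    have hsubK : comp G (far G A y) p ⊆ (comp G (far G A x) z).erase y := fun q hq =>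
      mem_erase.2 ⟨(mem_far.1 (comp_subset hq)).2.1, mem_filter.2 ⟨hsubx hq,
        (mem_filter.1 hpK).2.trans
          (((connOn_comp hpfar).2 p (mem_comp_self hpfar) q hq).mono hsubx)⟩⟩
    have h1 := card_le_card hsubK
    have h2 := card_erase_add_one hyK
    have h3 := hpmin (j := (y, p)) ⟨⟨hyA, hy9⟩, hpfar⟩ (by dsimp only; lia)
    dsimp only at h3
    lia
  have h1 := card_le_card hsub
  have h2 := card_erase_add_one (mem_insert_of_mem hv : v ∈ insert y (nbhd G A y))
  have h3 := card_erase_add_one (mem_erase.2 ⟨hwv, mem_insert_of_mem hw⟩ :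
    w ∈ (insert y (nbhd G A y)).erase v)
  rw [card_insert_of_notMem notMem_nbhd_self] at h2
  have h4 := hymin v hvK
  lia

variable {a b p q : V}

/-! ### Vertices of degree nine -/

/-- The vertices of `A` that have the same color as `x` or as `y`. -/
noncomputable def bicolored (A : Finset V) (c : V → Fin 8) (x y : V) : Finset V :=
  {w ∈ A | c w = c x ∨ c w = c y}

lemma mem_bicolored {c : V → Fin 8} : w ∈ bicolored A c x y ↔ w ∈ A ∧ (c w = c x ∨ c w = c y) :=
  mem_filter

lemma exists_connOn_bicolored {c : V → Fin 8} (h : Joined G (bicolored A c x y) x y) (hx : x ∈ A)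
    (hy : y ∈ A) :
    ∃ S ⊆ A, ConnOn G S ∧ x ∈ S ∧ y ∈ S ∧ ∀ w ∈ S, c w = c x ∨ c w = c y := by
  have hx' : x ∈ bicolored A c x y := mem_bicolored.2 ⟨hx, Or.inl rfl⟩
  exact ⟨comp G (bicolored A c x y) x, comp_subset.trans (filter_subset _ _), connOn_comp hx',
    mem_comp_self hx', mem_filter.2 ⟨mem_bicolored.2 ⟨hy, Or.inr rfl⟩, h⟩,
    fun w hw => (mem_bicolored.1 (comp_subset hw)).2⟩

/-- The configuration forced at a vertex `v` of degree nine in a minimal graph without `K_7`-minor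
that has no proper coloring with eight colors: any three neighbors of `v` span an edge, and for any
set `M` of neighbors of `v` that misses two nonadjacent neighbors there is a coloring in which the
vertices of `M` have private colors and are pairwise joined by Kempe chains. -/
structure Obstruction (G : SimpleGraph V) (A : Finset V) (v : V) : Prop where
  not_kMinor : ¬ KMinor G 7 A
  mem : v ∈ A
  card_nbhd : #(nbhd G A v) = 9
  adj : ∀ x ∈ nbhd G A v, ∀ y ∈ nbhd G A v, ∀ z ∈ nbhd G A v, x ≠ y → x ≠ z → y ≠ z →
    ¬ G.Adj x y → ¬ G.Adj x z → G.Adj y z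
  kempe : ∀ M ⊆ nbhd G A v, ¬ G.IsClique ((nbhd G A v \ M : Finset V) : Set V) →
    ∃ c : V → Fin 8, (∀ x ∈ M, ∀ y ∈ nbhd G A v, c y = c x → y = x) ∧
      ∀ x ∈ M, ∀ y ∈ M, Joined G (bicolored (A.erase v) c x y) x y

lemma isClique_insert_of_adj (hB : G.IsClique (B : Set V)) (h : ∀ b ∈ B, G.Adj x b) :
    G.IsClique (insert x B : Finset V) := by
  rw [coe_insert]
  exact hB.insert fun b hb _ => h b hb

lemma kMinor_seven_of_isClique (hv : v ∈ A) (hB : B ⊆ nbhd G A v) (hcl : G.IsClique (B : Set V))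
    (h4 : 4 ≤ #B) (hS : ConnOn G S) (hT : ConnOn G T) (hSA : S ⊆ A.erase v) (hTA : T ⊆ A.erase v)
    (hSB : Disjoint S B) (hTB : Disjoint T B) (hTS : Disjoint T S)
    (hBS : ∀ b ∈ B, ∃ s ∈ S, G.Adj b s) (hBT : ∀ b ∈ B, ∃ t ∈ T, G.Adj b t)
    (hxS : x ∈ S) (hx : x ∈ nbhd G A v) (hyT : y ∈ T) (hy : y ∈ nbhd G A v) (hxy : G.Adj x y) :
    KMinor G 7 A := by
  have hvB : v ∉ B := fun h => notMem_nbhd_self (hB h)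
  have hvS : v ∉ S := fun h => notMem_erase v A (hSA h)
  have hvT : v ∉ T := fun h => notMem_erase v A (hTA h)
  have h5 : KMinor G 5 (B ∪ {v}) := (kMinor_of_isClique hcl h4).cone (connOn_singleton v)
    (by simpa using hvB) fun b hb => ⟨v, mem_singleton_self v, (mem_nbhd.1 (hB hb)).2.symm⟩
  have h6 : RootedKMinor G 6 (B ∪ {v} ∪ S) (B ∪ {v} ∪ {x}) := by
    refine RootedKMinor.cone h5 hS ?_ ?_ ⟨x, hxS, by simp⟩ subset_union_left
    · rw [disjoint_union_right]
      exact ⟨hSB, by simpa using hvS⟩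
    · intro r hr _
      rcases mem_union.1 hr with hr | hr
      · exact hBS r hr
      · exact ⟨x, hxS, mem_singleton.1 hr ▸ (mem_nbhd.1 hx).2⟩
  refine (h6.cone hT ?_ ?_ ⟨y, hyT, mem_union_right _ hyT⟩ subset_union_left).kMinor.mono ?_
  · rw [disjoint_union_right, disjoint_union_right]
    exact ⟨⟨hTB, by simpa using hvT⟩, hTS⟩
  · intro r hr _
    rw [mem_union, mem_union, mem_singleton, mem_singleton] at hr
    rcases hr with (hr | rfl) | rfl
    · exact hBT r hr
    · exact ⟨y, hyT, (mem_nbhd.1 hy).2⟩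
    · exact ⟨y, hyT, hxy⟩
  · exact union_subset (union_subset (union_subset (hB.trans nbhd_subset) (by simpa using hv))
      (hSA.trans (erase_subset _ _))) (hTA.trans (erase_subset _ _))

namespace Obstruction

lemma card_le_five (h : Obstruction G A v) (hB : B ⊆ nbhd G A v) (hcl : G.IsClique (B : Set V)) :
    #B ≤ 5 := by
  by_contra! hlt
  exact h.not_kMinor (((kMinor_of_isClique hcl hlt).mono hB).of_nbhd h.mem)

lemma card_le_four (h : Obstruction G A v) (hB : B ⊆ nbhd G A v) (hcl : G.IsClique (B : Set V)) :
    #B ≤ 4 := by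
  by_contra! hlt
  have hB5 : #B = 5 := le_antisymm (h.card_le_five hB hcl) hlt
  have hN := h.card_nbhd
  obtain ⟨a, ha⟩ : (nbhd G A v \ B).Nonempty := by
    rw [← card_pos, card_sdiff_of_subset hB]; lia
  obtain ⟨ha, haB⟩ := mem_sdiff.1 ha
  have hva := (mem_nbhd.1 ha).2
  have hvB : v ∉ B := fun h => notMem_nbhd_self (hB h)
  have haT : a ∈ (A.erase v) \ B := mem_sdiff.2 ⟨nbhd_subset_erase ha, haB⟩
  have h6 : KMinor G 6 (B ∪ {v}) := (kMinor_of_isClique hcl hlt).cone (connOn_singleton v)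
    (by simpa using hvB) fun b hb => ⟨v, mem_singleton_self v, (mem_nbhd.1 (hB hb)).2.symm⟩
  refine h.not_kMinor ((h6.cone (connOn_comp haT) ?_ ?_).mono ?_)
  · rw [Finset.disjoint_left]
    intro w hw
    have := comp_subset hw
    simp only [mem_sdiff, mem_erase, mem_union, mem_singleton] at this ⊢
    tauto
  · intro b hb
    rcases mem_union.1 hb with hb | hb
    · have hM : ¬ G.IsClique ((nbhd G A v \ {a, b} : Finset V) : Set V) := fun hcl => by
        have h1 := h.card_le_five sdiff_subset hcl
        have h2 := le_card_sdiff {a, b} (nbhd G A v)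
        have h3 : #{a, b} ≤ 2 := card_le_two
        lia
      obtain ⟨c, hc, hJ⟩ := h.kempe {a, b} (by simp [insert_subset_iff, ha, hB hb]) hM
      have haM : a ∈ ({a, b} : Finset V) := mem_insert_self _ _
      have hbM : b ∈ ({a, b} : Finset V) := by simp
      obtain ⟨w, hw, hwb⟩ := exists_adj_of_joined (hJ a haM b hbM)
        (mem_bicolored.2 ⟨nbhd_subset_erase ha, Or.inl rfl⟩) fun hab => haB (hab ▸ hb)
      refine ⟨w, comp_mono (fun x hx => ?_) hw, hwb.symm⟩
      rw [mem_erase, mem_bicolored] at hx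
      refine mem_sdiff.2 ⟨hx.2.1, fun hxB => ?_⟩
      rcases hx.2.2 with hxa | hxb
      · exact haB (hc a haM x (hB hxB) hxa ▸ hxB)
      · exact hx.1 (hc b hbM x (hB hxB) hxb)
    · exact ⟨a, mem_comp_self haT, mem_singleton.1 hb ▸ hva⟩
  · exact union_subset (union_subset (hB.trans nbhd_subset) (by simpa using h.mem))
      (comp_subset.trans (sdiff_subset.trans (erase_subset _ _)))

lemma exists_not_adj (h : Obstruction G A v) (hB : B ⊆ nbhd G A v) (h5 : 5 ≤ #B) :
    ∃ p ∈ B, ∃ q ∈ B, q ≠ p ∧ ¬ G.Adj p q :=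
  (isClique_or_exists_not_adj G B).resolve_left fun hcl => by
    have := h.card_le_four hB hcl
    lia

lemma isClique_far (h : Obstruction G A v) (hB : B ⊆ nbhd G A v) (hu : u ∈ nbhd G A v) :
    G.IsClique (far G B u : Set V) := by
  intro p hp q hq hpq
  obtain ⟨hp, hpu, hup⟩ := mem_far.1 hp
  obtain ⟨hq, hqu, huq⟩ := mem_far.1 hq
  exact h.adj u hu p (hB hp) q (hB hq) hpu.symm hqu.symm hpq hup huq

lemma exists_isClique_three (h : Obstruction G A v) (hB : B ⊆ nbhd G A v) (h6 : 6 ≤ #B) :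
    ∃ T ⊆ B, G.IsClique (T : Set V) ∧ 3 ≤ #T := by
  obtain ⟨u, hu⟩ : B.Nonempty := card_pos.1 (by lia)
  have hcard : #B = #(far G B u) + (#(nbhd G B u) + 1) := by
    rw [far, card_sdiff_of_subset (insert_subset hu nbhd_subset),
      card_insert_of_notMem notMem_nbhd_self]
    have := card_le_card (insert_subset hu (nbhd_subset (G := G) (A := B) (x := u)))
    rw [card_insert_of_notMem notMem_nbhd_self] at this
    lia
  by_cases h3 : 3 ≤ #(far G B u)
  · exact ⟨_, sdiff_subset, h.isClique_far hB (hB hu), h3⟩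
  obtain ⟨x, hx, y, hy, z, hz, hxy, hxz, hyz⟩ := two_lt_card.1 (show 2 < #(nbhd G B u) by lia)
  have key : ∀ p ∈ nbhd G B u, ∀ q ∈ nbhd G B u, G.Adj p q →
      ∃ T ⊆ B, G.IsClique (T : Set V) ∧ 3 ≤ #T := by
    intro p hp q hq hpq
    obtain ⟨hpB, hup⟩ := mem_nbhd.1 hp
    obtain ⟨hqB, huq⟩ := mem_nbhd.1 hq
    have h3 : #{u, p, q} = 3 := card_eq_three.2 ⟨u, p, q, hup.ne, huq.ne, hpq.ne, rfl⟩
    refine ⟨{u, p, q}, by simp [insert_subset_iff, hu, hpB, hqB], ?_, h3.ge⟩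
    refine isClique_insert_of_adj (isClique_insert_of_adj (by simp) (by simpa using hpq)) ?_
    simp [hup, huq]
  by_cases hxy' : G.Adj x y
  · exact key x hx y hy hxy'
  by_cases hxz' : G.Adj x z
  · exact key x hx z hz hxz'
  exact key y hy z hz (h.adj x (hB (nbhd_subset hx)) y (hB (nbhd_subset hy)) z
    (hB (nbhd_subset hz)) hxy hxz hyz hxy' hxz')

lemma exists_isClique_four (h : Obstruction G A v) :
    ∃ B ⊆ nbhd G A v, G.IsClique (B : Set V) ∧ #B = 4 := by
  suffices hB : ∃ B ⊆ nbhd G A v, G.IsClique (B : Set V) ∧ 4 ≤ #B by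
    obtain ⟨B, hB, hcl, h4⟩ := hB
    exact ⟨B, hB, hcl, le_antisymm (h.card_le_four hB hcl) h4⟩
  by_contra! hcon
  have hN := h.card_nbhd
  have hdeg : ∀ u ∈ nbhd G A v, #(nbhd G (nbhd G A v) u) = 5 := by
    intro u hu
    have h1 := hcon (far G (nbhd G A v) u) sdiff_subset (h.isClique_far Subset.rfl hu)
    rw [far, card_sdiff_of_subset (insert_subset hu nbhd_subset),
      card_insert_of_notMem notMem_nbhd_self] at h1
    by_contra hne
    obtain ⟨T, hT, hcl, h3⟩ := h.exists_isClique_three (B := nbhd G (nbhd G A v) u) nbhd_subset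
      (by lia)
    have h2 := hcon (insert u T) (insert_subset hu (hT.trans nbhd_subset))
      (isClique_insert_of_adj hcl fun t ht => (mem_nbhd.1 (hT ht)).2)
    rw [card_insert_of_notMem fun hu => notMem_nbhd_self (hT hu)] at h2
    lia
  have h1 : dsum G (nbhd G A v) = 45 := by
    rw [dsum, sum_congr rfl hdeg, sum_const, hN, smul_eq_mul]
  have h2 := even_dsum G (nbhd G A v)
  rw [h1] at h2
  exact absurd h2 (by decide)

lemma adj_or_adj (h : Obstruction G A v) (hx : x ∈ nbhd G A v) (hy : y ∈ nbhd G A v)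
    (hz : z ∈ nbhd G A v) (hzx : z ≠ x) (hzy : z ≠ y) (hxy : x ≠ y) (h' : ¬ G.Adj x y) :
    G.Adj z x ∨ G.Adj z y := by
  by_contra! hcon
  exact h' (h.adj z hz x hx y hy hzx hzy hxy hcon.1 hcon.2)

lemma adj_of_not_adj (h : Obstruction G A v) (hB : B ⊆ nbhd G A v)
    (hcl : G.IsClique (B : Set V)) (h4 : 4 ≤ #B) (hT : T ⊆ nbhd G A v \ B)
    (hx : x ∈ T) (hy : y ∈ T) (hz : z ∈ T) (hw : w ∈ T) (hxy : x ≠ y) (hzw : z ≠ w)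
    (hxz : x ≠ z) (hxw : x ≠ w) (hyz : y ≠ z) (hyw : y ≠ w) (hxy' : ¬ G.Adj x y) :
    G.Adj z w := by
  by_contra hzw'
  have hxB := mem_sdiff.1 (hT hx)
  have hyB := mem_sdiff.1 (hT hy)
  have hzB := mem_sdiff.1 (hT hz)
  have hwB := mem_sdiff.1 (hT hw)
  have hM : 5 ≤ #(nbhd G A v \ {x, y, z, w}) := by
    have h1 := le_card_sdiff {x, y, z, w} (nbhd G A v)
    have h2 : #{x, y, z, w} ≤ 4 := Finset.card_le_four
    have h3 := h.card_nbhd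
    lia
  obtain ⟨c, hc, hJ⟩ := h.kempe {x, y, z, w} (by simp [insert_subset_iff, hxB, hyB, hzB, hwB])
    fun hcl => absurd (h.card_le_four sdiff_subset hcl) (by lia)
  simp only [mem_insert, mem_singleton, forall_eq_or_imp, forall_eq] at hc hJ
  obtain ⟨hcx, hcy, hcz, hcw⟩ := hc
  obtain ⟨S, hS, hSconn, hxS, hyS, hcS⟩ := exists_connOn_bicolored hJ.1.2.1
    (nbhd_subset_erase hxB.1) (nbhd_subset_erase hyB.1)
  obtain ⟨S', hS', hS'conn, hzS', hwS', hcS'⟩ := exists_connOn_bicolored hJ.2.2.1.2.2.2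
    (nbhd_subset_erase hzB.1) (nbhd_subset_erase hwB.1)
  have hadjS : ∀ p ∈ nbhd G A v, p ≠ x → p ≠ y → ∃ s ∈ S, G.Adj p s := fun p hp hpx hpy =>
    (h.adj_or_adj hxB.1 hyB.1 hp hpx hpy hxy hxy').elim (fun h => ⟨x, hxS, h⟩) fun h => ⟨y, hyS, h⟩
  have hne : ∀ b ∈ B, ∀ p, p ∉ B → b ≠ p := fun b hb p hp hbp => hp (hbp ▸ hb)
  have hdis : Disjoint S B := Finset.disjoint_left.2 fun p hp hpB => (hcS p hp).elim
    (fun h => hne p hpB x hxB.2 (hcx p (hB hpB) h)) fun h => hne p hpB y hyB.2 (hcy p (hB hpB) h)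
  have hdis' : Disjoint S' B := Finset.disjoint_left.2 fun p hp hpB => (hcS' p hp).elim
    (fun h => hne p hpB z hzB.2 (hcz p (hB hpB) h)) fun h => hne p hpB w hwB.2 (hcw p (hB hpB) h)
  have hdisS : Disjoint S' S := Finset.disjoint_left.2 fun p hp hp' => by
    rcases hcS p hp' with h1 | h1 <;> rcases hcS' p hp with h2 | h2 <;> rw [h1] at h2
    · exact hxz (hcz x hxB.1 h2)
    · exact hxw (hcw x hxB.1 h2)
    · exact hyz (hcz y hyB.1 h2)
    · exact hyw (hcw y hyB.1 h2)
  have hBS' : ∀ b ∈ B, ∃ s ∈ S', G.Adj b s := fun b hb =>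
    (h.adj_or_adj hzB.1 hwB.1 (hB hb) (hne b hb z hzB.2) (hne b hb w hwB.2) hzw hzw').elim
      (fun h => ⟨z, hzS', h⟩) fun h => ⟨w, hwS', h⟩
  have hBS : ∀ b ∈ B, ∃ s ∈ S, G.Adj b s := fun b hb =>
    hadjS b (hB hb) (hne b hb x hxB.2) (hne b hb y hyB.2)
  have key : ∀ t ∈ S', t ∈ nbhd G A v → G.Adj x t → False := fun t ht htN hxt =>
    h.not_kMinor (kMinor_seven_of_isClique h.mem hB hcl h4 hSconn hS'conn hS hS' hdis hdis' hdisS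
      hBS hBS' hxS hxB.1 ht htN hxt)
  exact (h.adj_or_adj hzB.1 hwB.1 hxB.1 hxz hxw hzw hzw').elim (key z hzS' hzB.1)
    (key w hwS' hwB.1)

/-- A triangle `R` in the neighborhood has no neighbor in a disjoint `K_4` of the neighborhood if
it is complete to one of two further nonadjacent neighbors. -/
lemma not_adj_of_isClique (h : Obstruction G A v) (hB : B ⊆ nbhd G A v)
    (hcl : G.IsClique (B : Set V)) (h4 : #B = 4) (hR : R ⊆ nbhd G A v)
    (hp : p ∈ nbhd G A v) (hq : q ∈ nbhd G A v) (hpB : p ∉ B) (hqB : q ∉ B) (hpR : p ∉ R)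
    (hqR : q ∉ R) (hBR : Disjoint B R) (hRcl : G.IsClique (R : Set V)) (h3 : #R = 3)
    (hqR' : ∀ r ∈ R, G.Adj q r) (hpq : p ≠ q) (hpq' : ¬ G.Adj p q) :
    ∀ b ∈ B, ∀ r ∈ R, ¬ G.Adj b r := by
  have hne : ∀ b ∈ B, ∀ x, x ∉ B → b ≠ x := fun b hb x hx hbx => hx (hbx ▸ hb)
  have hRB : ∀ r ∈ R, r ∉ B := fun r hr hrB => Finset.disjoint_left.1 hBR hrB hr
  let U := {b ∈ B | ∃ r ∈ R, G.Adj b r}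
  have hUB : U ⊆ B := filter_subset _ _
  have hUR : G.IsClique ((U ∪ R : Finset V) : Set V) := by
    by_contra hU
    obtain ⟨a, ha, b, hb, hba, hab⟩ := (isClique_or_exists_not_adj _ _).resolve_left hU
    have hUN : U ∪ R ⊆ nbhd G A v := union_subset (hUB.trans hB) hR
    have hne' : ∀ x ∈ U ∪ R, ∀ y, y ∉ B → y ∉ R → y ≠ x := by
      rintro x hx y hyB hyR rfl
      exact (mem_union.1 hx).elim (fun h => hyB (hUB h)) hyR
    obtain ⟨c, hc, hJ⟩ := h.kempe (((nbhd G A v).erase a).erase b)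
      ((erase_subset _ _).trans (erase_subset _ _)) fun hM =>
        hab (hM (by simp [hUN ha]) (by simp [hUN hb]) hba.symm)
    have hmem : ∀ x ∈ nbhd G A v, x ≠ a → x ≠ b → x ∈ ((nbhd G A v).erase a).erase b :=
      fun x hx hxa hxb => mem_erase.2 ⟨hxb, mem_erase.2 ⟨hxa, hx⟩⟩
    have hpM := hmem p hp (hne' a ha p hpB hpR) (hne' b hb p hpB hpR)
    have hqM := hmem q hq (hne' a ha q hqB hqR) (hne' b hb q hqB hqR)
    obtain ⟨r, hr⟩ : (R \ {a, b}).Nonempty := by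
      rw [← card_pos]
      have h1 := le_card_sdiff {a, b} R
      have h2 : #{a, b} ≤ 2 := card_le_two
      lia
    simp only [mem_sdiff, mem_insert, mem_singleton, not_or] at hr
    obtain ⟨hr, hra, hrb⟩ := hr
    have hrM := hmem r (hR hr) hra hrb
    obtain ⟨S, hS, hSconn, hpS, hqS, hcS⟩ := exists_connOn_bicolored (hJ p hpM q hqM)
      (nbhd_subset_erase hp) (nbhd_subset_erase hq)
    let Y := {w ∈ A.erase v \ B | c w ≠ c p ∧ c w ≠ c q}
    have hcol : ∀ x ∈ nbhd G A v, x ≠ p → x ≠ q → c x ≠ c p ∧ c x ≠ c q := fun x hx hxp hxq =>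
      ⟨fun h => hxp (hc p hpM x hx h), fun h => hxq (hc q hqM x hx h)⟩
    have hRcol : ∀ r ∈ R, c r ≠ c p ∧ c r ≠ c q := fun r hr =>
      hcol r (hR hr) (fun h => hpR (h ▸ hr)) fun h => hqR (h ▸ hr)
    have hRY : R ⊆ Y := fun r hr => mem_filter.2
      ⟨mem_sdiff.2 ⟨nbhd_subset_erase (hR hr), hRB r hr⟩, hRcol r hr⟩
    have hYA : Y ⊆ A.erase v := (filter_subset _ _).trans sdiff_subset
    have hRT : R ⊆ comp G Y r := by
      intro r' hr'
      by_cases hrr' : r = r'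
      · exact hrr' ▸ mem_comp_self (hRY hr)
      · exact mem_comp_of_adj (mem_comp_self (hRY hr)) (hRcl hr hr' hrr') (hRY hr')
    refine h.not_kMinor (kMinor_seven_of_isClique h.mem hB hcl h4.ge hSconn (connOn_comp (hRY hr))
      hS (comp_subset.trans hYA) ?_ ?_ ?_ ?_ ?_ hqS hq (hRT hr) (hR hr) (hqR' r hr))
    · refine Finset.disjoint_left.2 fun w hw hwB => ?_
      have := hcol w (hB hwB) (hne w hwB p hpB) (hne w hwB q hqB)
      exact (hcS w hw).elim this.1 this.2
    · exact Finset.disjoint_left.2 fun w hw =>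
        (mem_sdiff.1 (mem_filter.1 (comp_subset hw)).1).2
    · exact Finset.disjoint_left.2 fun w hw hwS => (hcS w hwS).elim
        (mem_filter.1 (comp_subset hw)).2.1 (mem_filter.1 (comp_subset hw)).2.2
    · exact fun w hw => (h.adj_or_adj hp hq (hB hw) (hne w hw p hpB) (hne w hw q hqB) hpq
        hpq').elim (fun h => ⟨p, hpS, h⟩) fun h => ⟨q, hqS, h⟩
    · intro w hw
      by_cases hwU : w ∈ U
      · obtain ⟨r', hr', hwr'⟩ := (mem_filter.1 hwU).2
        exact ⟨r', hRT hr', hwr'⟩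
      have hwUR : ∀ x ∈ U ∪ R, w ≠ x := by
        rintro x hx rfl
        exact (mem_union.1 hx).elim hwU fun h => hRB w h hw
      have hwM := hmem w (hB hw) (hwUR a ha) (hwUR b hb)
      obtain ⟨t, ht, htw⟩ := exists_adj_of_joined (hJ r hrM w hwM)
        (mem_bicolored.2 ⟨nbhd_subset_erase (hR hr), Or.inl rfl⟩) (hne w hw r (hRB r hr)).symm
      refine ⟨t, comp_mono (fun x hx => ?_) ht, htw.symm⟩
      obtain ⟨hxw, hx⟩ := mem_erase.1 hx
      obtain ⟨hxA, hx⟩ := mem_bicolored.1 hx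
      refine mem_filter.2 ⟨mem_sdiff.2 ⟨hxA, fun hxB => ?_⟩, ?_⟩
      · rcases hx with hx | hx
        · exact hRB r hr (hc r hrM x (hB hxB) hx ▸ hxB)
        · exact hxw (hc w hwM x (hB hxB) hx)
      · rcases hx with hx | hx <;> rw [hx]
        · exact hRcol r hr
        · exact hcol w (hB hw) (hne w hw p hpB) (hne w hw q hqB)
  intro b hb r hr hbr
  have hbU : b ∈ U := mem_filter.2 ⟨hb, r, hr, hbr⟩
  have hU1 : ∀ b' ∈ B, b' ≠ b → ∀ r ∈ R, ¬ G.Adj b' r := by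
    intro b' hb' hbb' r hr hbr'
    have h1 := h.card_le_four (union_subset (hUB.trans hB) hR) hUR
    rw [card_union_of_disjoint (hBR.mono_left hUB), h3] at h1
    have h2 : b' ∈ U := mem_filter.2 ⟨hb', r, hr, hbr'⟩
    exact hbb' (card_le_one.1 (by lia) b' h2 b hbU)
  have hbR : ∀ r ∈ R, G.Adj b r := fun r hr =>
    hUR (by simp [hbU]) (by simp [hr]) (hne b hb r (hRB r hr))
  have hbR' : b ∉ R := fun h => hRB b h hb
  have hclbR := isClique_insert_of_adj hRcl hbR
  have hno : ∀ x ∈ nbhd G A v, x ∉ R → x ≠ b → (∀ r ∈ R, G.Adj x r) → ¬ G.Adj x b := by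
    intro x hx hxR hxb hxr hxb'
    have h1 := h.card_le_four (B := insert x (insert b R))
      (insert_subset hx (insert_subset (hB hb) hR)) (isClique_insert_of_adj hclbR (by simp_all))
    rw [card_insert_of_notMem (by simp [hxb, hxR]), card_insert_of_notMem hbR'] at h1
    lia
  have hpb : G.Adj b p := (h.adj_or_adj hp hq (hB hb) (hne b hb p hpB) (hne b hb q hqB) hpq
    hpq').resolve_right fun h => hno q hq hqR (hne b hb q hqB).symm hqR' h.symm
  obtain ⟨b', hb', hpb'⟩ : ∃ b' ∈ B, ¬ G.Adj p b' := by
    by_contra! hcon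
    have h1 := h.card_le_four (insert_subset hp hB) (isClique_insert_of_adj hcl hcon)
    rw [card_insert_of_notMem hpB] at h1
    lia
  refine hno p hp hpR (hne b hb p hpB).symm (fun r hr => ?_) hpb.symm
  refine ((h.adj_or_adj hp (hB hb') (hR hr) (fun h => hpR (h ▸ hr)) (hne b' hb' r (hRB r hr)).symm
    (hne b' hb' p hpB).symm hpb').resolve_right fun h => ?_).symm
  exact hU1 b' hb' (fun h => hpb' (h ▸ hpb.symm)) r hr h.symm

lemma false_of_isClique (h : Obstruction G A v) (hB : B ⊆ nbhd G A v)
    (hcl : G.IsClique (B : Set V)) (h4 : #B = 4) (hR : R ⊆ nbhd G A v)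
    (hp : p ∈ nbhd G A v) (hq : q ∈ nbhd G A v) (hpB : p ∉ B) (hqB : q ∉ B) (hpR : p ∉ R)
    (hqR : q ∉ R) (hBR : Disjoint B R) (hRcl : G.IsClique (R : Set V)) (h3 : #R = 3)
    (hqR' : ∀ r ∈ R, G.Adj q r) (hpq : p ≠ q) (hpq' : ¬ G.Adj p q) : False := by
  have hBR' := h.not_adj_of_isClique hB hcl h4 hR hp hq hpB hqB hpR hqR hBR hRcl h3 hqR' hpq hpq'
  have hne : ∀ b ∈ B, ∀ x, x ∉ B → b ≠ x := fun b hb x hx hbx => hx (hbx ▸ hb)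
  have hRB : ∀ r ∈ R, r ∉ B := fun r hr hrB => Finset.disjoint_left.1 hBR hrB hr
  have hex : ∀ x ∈ nbhd G A v, x ∉ B → ∃ b ∈ B, ¬ G.Adj x b := by
    intro x hx hxB
    by_contra! hcon
    have h1 := h.card_le_four (insert_subset hx hB) (isClique_insert_of_adj hcl hcon)
    rw [card_insert_of_notMem hxB] at h1
    lia
  have hfar : ∀ x ∈ nbhd G A v, ∀ y ∈ nbhd G A v, x ≠ y → x ∉ B → y ∉ B → x ∉ R → y ∉ R →
      (∀ r ∈ R, G.Adj x r) → ∀ b ∈ B, ¬ G.Adj y b → ∀ b' ∈ B, b' ≠ b → ¬ G.Adj x b' := by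
    intro x hx y hy hxy hxB hyB hxR hyR hxR' b hb hyb b' hb' hbb'
    have hbR : b ∉ R := fun h => hRB b h hb
    refine h.not_adj_of_isClique (B := insert x R) (R := B.erase b) (insert_subset hx hR)
      (isClique_insert_of_adj hRcl hxR') (by rw [card_insert_of_notMem hxR, h3])
      ((erase_subset _ _).trans hB) hy (hB hb) (by simp [hxy.symm, hyR])
      (by simp [hne b hb x hxB, hbR]) (fun h => hyB (mem_of_mem_erase h)) (by simp) ?_
      (hcl.subset (by simp)) (by rw [card_erase_of_mem hb, h4]) ?_ (hne b hb y hyB).symm hyb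
      x (mem_insert_self _ _) b' (mem_erase.2 ⟨hbb', hb'⟩)
    · rw [disjoint_insert_left]
      exact ⟨fun h => hxB (mem_of_mem_erase h), hBR.symm.mono_right (erase_subset _ _)⟩
    · exact fun r hr => hcl hb (mem_of_mem_erase hr) (ne_of_mem_erase hr).symm
  obtain ⟨b₁, hb₁, hpb₁⟩ := hex p hp hpB
  obtain ⟨b₂, hb₂, hqb₂⟩ := hex q hq hqB
  have hpR' : ∀ r ∈ R, G.Adj p r := fun r hr =>
    ((h.adj_or_adj hp (hB hb₁) (hR hr) (fun h => hpR (h ▸ hr)) (hne b₁ hb₁ r (hRB r hr)).symm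
      (hne b₁ hb₁ p hpB).symm hpb₁).resolve_right fun h => hBR' b₁ hb₁ r hr h.symm).symm
  obtain ⟨b, hb⟩ : (B \ {b₁, b₂}).Nonempty := by
    rw [← card_pos]
    have h1 := le_card_sdiff {b₁, b₂} B
    have h2 : #{b₁, b₂} ≤ 2 := card_le_two
    lia
  simp only [mem_sdiff, mem_insert, mem_singleton, not_or] at hb
  obtain ⟨hb, hbb₁, hbb₂⟩ := hb
  rcases h.adj_or_adj hp hq (hB hb) (hne b hb p hpB) (hne b hb q hqB) hpq hpq' with h' | h'
  · exact hfar p hp q hq hpq hpB hqB hpR hqR hpR' b₂ hb₂ hqb₂ b hb hbb₂ h'.symm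
  · exact hfar q hq p hp hpq.symm hqB hpB hqR hpR hqR' b₁ hb₁ hpb₁ b hb hbb₁ h'.symm

theorem false (h : Obstruction G A v) : False := by
  obtain ⟨B, hB, hcl, h4⟩ := h.exists_isClique_four
  have hN := h.card_nbhd
  have h5 : #(nbhd G A v \ B) = 5 := by rw [card_sdiff_of_subset hB]; lia
  obtain ⟨p, hp, q, hq, hqp, hpq⟩ := h.exists_not_adj sdiff_subset h5.ge
  obtain ⟨hpN, hpB⟩ := mem_sdiff.1 hp
  obtain ⟨hqN, hqB⟩ := mem_sdiff.1 hq
  let R := ((nbhd G A v \ B).erase p).erase q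
  have hRsub : R ⊆ nbhd G A v \ B := (erase_subset _ _).trans (erase_subset _ _)
  have hR : R ⊆ nbhd G A v := hRsub.trans sdiff_subset
  have hpR : p ∉ R := by simp [R]
  have hqR : q ∉ R := by simp [R]
  have h3 : #R = 3 := by
    rw [card_erase_of_mem (mem_erase.2 ⟨hqp, hq⟩), card_erase_of_mem hp, h5]
  have hne : ∀ r ∈ R, ∀ x, x ∉ R → x ≠ r := fun r hr x hx hxr => hx (hxr ▸ hr)
  have hBR : Disjoint B R := disjoint_sdiff.mono_right hRsub
  have hRcl : G.IsClique (R : Set V) := fun r hr s hs hrs =>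
    h.adj_of_not_adj hB hcl h4.ge Subset.rfl hp hq (hRsub hr) (hRsub hs) hqp.symm hrs
      (hne r hr p hpR) (hne s hs p hpR) (hne r hr q hqR) (hne s hs q hqR) hpq
  by_cases hqR' : ∀ r ∈ R, G.Adj q r
  · exact h.false_of_isClique hB hcl h4 hR hpN hqN hpB hqB hpR hqR hBR hRcl h3 hqR' hqp.symm hpq
  by_cases hpR' : ∀ r ∈ R, G.Adj p r
  · exact h.false_of_isClique hB hcl h4 hR hqN hpN hqB hpB hqR hpR hBR hRcl h3 hpR' hqp
      fun h => hpq h.symm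
  push Not at hqR' hpR'
  obtain ⟨r, hr, hqr⟩ := hqR'
  obtain ⟨s, hs, hps⟩ := hpR'
  by_cases hrs : r = s
  · subst hrs
    exact (h.adj_or_adj hpN hqN (hR hr) (hne r hr p hpR).symm (hne r hr q hqR).symm hqp.symm
      hpq).elim (fun h => hps h.symm) fun h => hqr h.symm
  · exact hqr (h.adj_of_not_adj hB hcl h4.ge Subset.rfl hp (hRsub hs) hq (hRsub hr)
      (hne s hs p hpR) (hne r hr q hqR) hqp.symm (hne r hr p hpR) (hne s hs q hqR).symm
      (fun h => hrs h.symm) hps)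

end Obstruction

/-! ### Colorings with eight colors -/

/-- `c` is a proper coloring of the subgraph induced by `A`. -/
def ProperOn (G : SimpleGraph V) (A : Finset V) (c : V → Fin 8) : Prop :=
  ∀ x ∈ A, ∀ y ∈ A, G.Adj x y → c x ≠ c y

lemma exists_color_nbhd {c : V → Fin 8} (hno : ∀ c, ¬ ProperOn G A c)
    (hc : ProperOn G (A.erase v) c) (i : Fin 8) : ∃ w ∈ nbhd G A v, c w = i := by
  by_contra! hcon
  have hv : ∀ y ∈ A, G.Adj v y → i ≠ c y := fun y hy h => (hcon y (mem_nbhd.2 ⟨hy, h⟩)).symm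
  refine hno (Function.update c v i) fun x hx y hy hxy => ?_
  by_cases hxv : x = v
  · subst hxv
    rw [Function.update_self, Function.update_of_ne hxy.ne']
    exact hv y hy hxy
  rw [Function.update_of_ne hxv]
  by_cases hyv : y = v
  · subst hyv
    rw [Function.update_self]
    exact (hv x hx hxy.symm).symm
  rw [Function.update_of_ne hyv]
  exact hc x (mem_erase.2 ⟨hxv, hx⟩) y (mem_erase.2 ⟨hyv, hy⟩) hxy

lemma connOn_insert_of_adj (h : ∀ t ∈ T, G.Adj v t) : ConnOn G (insert v T) := by
  have key : ∀ t ∈ insert v T, Joined G (insert v T) v t := by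
    intro t ht
    rcases mem_insert.1 ht with rfl | ht'
    · exact ReflTransGen.refl
    · exact Joined.of_adj (h t ht') (mem_insert_self _ _) ht
  exact ⟨insert_nonempty _ _, fun x hx y hy => (key x hx).symm.trans (key y hy)⟩

/-- An independent set of neighbors of `v` can be given a color that is not used on the other
neighbors, if all graphs on fewer vertices can be colored. -/
lemma exists_properOn_erase {a : V} (hk : ¬ KMinor G 7 A)
    (ih : ∀ (G' : SimpleGraph V) (A' : Finset V), #A' < #A → ¬ KMinor G' 7 A' →
      ∃ c, ProperOn G' A' c) (hv : v ∈ A) (hT : T ⊆ nbhd G A v) (ha : a ∈ T)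
    (hind : ∀ x ∈ T, ∀ y ∈ T, ¬ G.Adj x y) :
    ∃ c, ProperOn G (A.erase v) c ∧ (∀ t ∈ T, c t = c a) ∧
      ∀ w ∈ nbhd G A v, w ∉ T → c w ≠ c a := by
  let C := insert v (T.erase a)
  have hav : a ≠ v := ne_of_mem_erase (nbhd_subset_erase (hT ha))
  have hCA : C ⊆ A := insert_subset hv ((erase_subset _ _).trans (hT.trans nbhd_subset))
  have hC : insert a C = insert v T := by rw [insert_comm, insert_erase ha]
  have hlt : #(A \ C) < #A := card_lt_card
    (ssubset_of_subset_of_ne sdiff_subset fun h => (mem_sdiff.1 (h ▸ hv)).2 (mem_insert_self _ _))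
  obtain ⟨c, hc⟩ := ih (contr G a C) (A \ C) hlt fun h => hk <| by
    have := h.of_contr (hC ▸ connOn_insert_of_adj fun t ht => (mem_nbhd.1 (hT ht)).2)
      disjoint_sdiff
    rwa [sdiff_union_of_subset hCA] at this
  have haC : a ∈ A \ C := mem_sdiff.2 ⟨nbhd_subset (hT ha), by simp [C, hav]⟩
  have hout : ∀ w ∈ A.erase v, w ∉ T → w ∈ A \ C := fun w hw hwT => mem_sdiff.2
    ⟨mem_of_mem_erase hw, fun h => (mem_insert.1 h).elim (ne_of_mem_erase hw)
      fun h => hwT (mem_of_mem_erase h)⟩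
  have hTa : ∀ x ∈ insert v T, ∀ y ∈ A.erase v, y ∉ T → G.Adj x y → c a ≠ c y := by
    intro x hx y hy hyT hxy
    refine hc a haC y (hout y hy hyT) ⟨fun h => hyT (h ▸ ha), ?_⟩
    rw [← hC] at hx
    rcases mem_insert.1 hx with rfl | hx
    · exact Or.inl hxy
    · exact Or.inr (Or.inl ⟨rfl, x, hx, hxy⟩)
  refine ⟨fun w => if w ∈ T then c a else c w, fun x hx y hy hxy => ?_, fun t ht => ?_,
    fun w hw hwT => ?_⟩
  · by_cases hxT : x ∈ T <;> by_cases hyT : y ∈ T <;> simp only [hxT, hyT, if_true, if_false]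
    · exact absurd hxy (hind x hxT y hyT)
    · exact hTa x (mem_insert_of_mem hxT) y hy hyT hxy
    · exact (hTa y (mem_insert_of_mem hyT) x hx hxT hxy.symm).symm
    · exact hc x (hout x hx hxT) y (hout y hy hyT) ⟨hxy.ne, Or.inl hxy⟩
  · simp only [ht, ha, if_true]
  · simp only [hwT, ha, if_true, if_false]
    exact (hTa v (mem_insert_self _ _) w (nbhd_subset_erase hw) hwT (mem_nbhd.1 hw).2).symm

lemma joined_bicolored {c : V → Fin 8} (hno : ∀ c, ¬ ProperOn G A c)
    (hc : ProperOn G (A.erase v) c) (hx : x ∈ nbhd G A v)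
    (hcx : ∀ w ∈ nbhd G A v, c w = c x → w = x) (hcy : ∀ w ∈ nbhd G A v, c w = c y → w = y) :
    Joined G (bicolored (A.erase v) c x y) x y := by
  by_contra hJ
  let W := comp G (bicolored (A.erase v) c x y) x
  have hxW : x ∈ W := mem_comp_self (mem_bicolored.2 ⟨nbhd_subset_erase hx, Or.inl rfl⟩)
  have hyW : y ∉ W := fun h => hJ (mem_filter.1 h).2
  let σ := Equiv.swap (c x) (c y)
  have hW : ∀ p ∈ W, ∀ q ∈ A.erase v, q ∉ W → G.Adj p q → σ (c p) ≠ c q := by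
    intro p hp q hq hqW hpq h
    refine hqW (mem_comp_of_adj hp hpq (mem_bicolored.2 ⟨hq, ?_⟩))
    rw [← h]
    rcases (mem_bicolored.1 (comp_subset hp)).2 with h | h <;> rw [h]
    · exact Or.inr (Equiv.swap_apply_left _ _)
    · exact Or.inl (Equiv.swap_apply_right _ _)
  obtain ⟨w, hw, hwx⟩ := exists_color_nbhd (c := fun w => if w ∈ W then σ (c w) else c w) hno
    (fun p hp q hq hpq => by
      by_cases hpW : p ∈ W <;> by_cases hqW : q ∈ W <;> simp only [hpW, hqW, if_true, if_false]
      · exact fun h => hc p hp q hq hpq (σ.injective h)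
      · exact hW p hpW q hq hqW hpq
      · exact (hW q hqW p hp hpW hpq.symm).symm
      · exact hc p hp q hq hpq) (c x)
  by_cases hwW : w ∈ W <;> simp only [hwW, if_true, if_false] at hwx
  · rw [← Equiv.swap_apply_right (c x) (c y)] at hwx
    exact hyW (hcy w hw (σ.injective hwx) ▸ hwW)
  · exact hwW (hcx w hw hwx ▸ hxW)

theorem exists_properOn (hk : ¬ KMinor G 7 A) : ∃ c, ProperOn G A c := by
  induction hn : #A using Nat.strong_induction_on generalizing G A with
  | _ n ih =>
  subst hn
  replace ih : ∀ (G' : SimpleGraph V) (A' : Finset V), #A' < #A → ¬ KMinor G' 7 A' →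
      ∃ c, ProperOn G' A' c := fun G' A' hlt hk' => ih _ hlt hk' rfl
  by_contra! hno
  have hne : A.Nonempty := by
    rw [nonempty_iff_ne_empty]
    rintro rfl
    exact hno (fun _ => 0) (by simp [ProperOn])
  have h8 : ∀ v ∈ A, 8 ≤ #(nbhd G A v) := by
    intro v hv
    obtain ⟨c, hc⟩ := ih G (A.erase v) (card_erase_lt_of_mem hv) fun h =>
      hk (h.mono (erase_subset _ _))
    have h1 : (univ : Finset (Fin 8)) ⊆ (nbhd G A v).image c := fun i _ =>
      mem_image.2 (exists_color_nbhd hno hc i)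
    have h2 := (card_le_card h1).trans card_image_le
    simpa using h2
  obtain ⟨v, hv, hv9⟩ : ∃ v ∈ A, #(nbhd G A v) ≤ 9 := by
    by_contra! hcon
    obtain ⟨v, hv⟩ := hne
    refine hk (kMinor_seven ?_ ?_)
    · have h1 := h8 v hv
      have h2 := card_le_card (nbhd_subset (G := G) (A := A) (x := v))
      lia
    · have := mul_card_le_dsum hcon
      lia
  have hcount : ∀ T ⊆ nbhd G A v, ∀ a ∈ T, ∀ c, ProperOn G (A.erase v) c →
      (∀ t ∈ T, c t = c a) → 7 ≤ #((nbhd G A v \ T).image c) := by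
    intro T hT a ha c hc hca
    have h1 : (univ : Finset (Fin 8)) ⊆ insert (c a) ((nbhd G A v \ T).image c) := by
      intro i _
      obtain ⟨w, hw, rfl⟩ := exists_color_nbhd hno hc i
      by_cases hwT : w ∈ T
      · exact mem_insert.2 (Or.inl (hca w hwT))
      · exact mem_insert_of_mem (mem_image_of_mem c (mem_sdiff.2 ⟨hw, hwT⟩))
    have h2 := (card_le_card h1).trans (card_insert_le _ _)
    rw [card_univ, Fintype.card_fin] at h2
    lia
  have hind : ∀ T ⊆ nbhd G A v, (∀ x ∈ T, ∀ y ∈ T, ¬ G.Adj x y) → #T + 7 ≤ #(nbhd G A v) := by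
    intro T hT hTind
    obtain rfl | ⟨a, ha⟩ := T.eq_empty_or_nonempty
    · have := h8 v hv
      rw [card_empty]
      lia
    obtain ⟨c, hc, hca, -⟩ := exists_properOn_erase hk ih hv hT ha hTind
    have h1 := (hcount T hT a ha c hc hca).trans card_image_le
    rw [card_sdiff_of_subset hT] at h1
    have h2 := card_le_card hT
    lia
  have hpair : ∀ a ∈ nbhd G A v, ∀ b ∈ nbhd G A v, ¬ G.Adj a b →
      {a, b} ⊆ nbhd G A v ∧ ∀ x ∈ ({a, b} : Finset V), ∀ y ∈ ({a, b} : Finset V), ¬ G.Adj x y := by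
    intro a ha b hb hab
    refine ⟨by simp [insert_subset_iff, ha, hb], ?_⟩
    simpa [hab] using fun h => hab h.symm
  have h9 : #(nbhd G A v) = 9 := by
    rcases isClique_or_exists_not_adj G (nbhd G A v) with hcl | ⟨a, ha, b, hb, hba, hab⟩
    · have h1 := h8 v hv
      exact absurd ((kMinor_of_isClique hcl (by lia)).mono nbhd_subset) hk
    · obtain ⟨hT, hTind⟩ := hpair a ha b hb hab
      have h1 := hind {a, b} hT hTind
      rw [card_pair hba.symm] at h1
      lia
  refine Obstruction.false (G := G) (A := A) (v := v) ⟨hk, hv, h9, ?_, ?_⟩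
  · intro x hx y hy z hz hxy hxz hyz hxy' hxz'
    by_contra hyz'
    have h1 := hind {x, y, z} (by simp [insert_subset_iff, hx, hy, hz])
      (by simp [hxy', hxz', hyz', G.adj_comm y x, G.adj_comm z x, G.adj_comm z y])
    rw [card_eq_three.2 ⟨x, y, z, hxy, hxz, hyz, rfl⟩] at h1
    lia
  · intro M hM hcl
    obtain ⟨a, ha, b, hb, hba, hab⟩ := (isClique_or_exists_not_adj _ _).resolve_left hcl
    rw [mem_sdiff] at ha hb
    obtain ⟨hT, hTind⟩ := hpair a ha.1 b hb.1 hab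
    obtain ⟨c, hc, hca, hca'⟩ := exists_properOn_erase hk ih hv hT (mem_insert_self a _) hTind
    have hinj : Set.InjOn c ((nbhd G A v \ {a, b} : Finset V) : Set V) := by
      refine card_image_iff.1 (le_antisymm card_image_le ?_)
      refine le_trans ?_ (hcount _ hT a (mem_insert_self a _) c hc hca)
      rw [card_sdiff_of_subset hT, card_pair hba.symm, h9]
    have hM' : ∀ x ∈ M, x ∉ ({a, b} : Finset V) := fun x hx h => by
      rcases mem_insert.1 h with rfl | h
      · exact ha.2 hx
      · exact hb.2 (mem_singleton.1 h ▸ hx)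
    have huniq : ∀ x ∈ M, ∀ y ∈ nbhd G A v, c y = c x → y = x := by
      intro x hx y hy hxy
      by_cases hyT : y ∈ ({a, b} : Finset V)
      · exact absurd (hxy.symm.trans (hca y hyT)) (hca' x (hM hx) (hM' x hx))
      · exact hinj (mem_coe.2 (mem_sdiff.2 ⟨hy, hyT⟩))
          (mem_coe.2 (mem_sdiff.2 ⟨hM hx, hM' x hx⟩)) hxy
    exact ⟨c, huniq, fun x hx y hy =>
      joined_bicolored hno hc (hM hx) (huniq x hx) (huniq y hy)⟩

end CliqueMinor

/-- Every finite simple graph with no `K_7`-minor has chromatic number at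
most 8. -/
theorem statement9 {V : Type} [Fintype V] (G : SimpleGraph V)
    (hfree : ¬ (⊤ : SimpleGraph (Fin 7)).MinorOf G) :
    G.chromaticNumber ≤ 8 := by
  obtain ⟨c, hc⟩ := CliqueMinor.exists_properOn (A := Finset.univ) fun h => hfree h.minorOf
  exact SimpleGraph.Colorable.chromaticNumber_le (n := 8)
    ⟨SimpleGraph.Coloring.mk c fun {x y} h => hc x (Finset.mem_univ x) y (Finset.mem_univ y) h⟩
end

section
/- Let G be a k-minor-critical finite simple graph. Then for every separation (A, B) of G, the induced subgraph G[A ∩ B] is not a split graph; equivalently, G[A ∩ B] contains C_4, C_5 or 2K_2 as an induced subgraph. -/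
open SimpleGraph

/-- `G` is `k`-minor-critical: its chromatic number is `k` and every strict
minor (a minor not isomorphic to `G`) has chromatic number less than `k`. -/
def SimpleGraph.MinorCritical {V : Type} (G : SimpleGraph V) (k : ℕ) : Prop :=
  G.chromaticNumber = (k : ℕ∞) ∧
  ∀ (W : Type) (H : SimpleGraph W), H.MinorOf G → IsEmpty (H ≃g G) →
    H.chromaticNumber < (k : ℕ∞)

/-- A split graph: the vertex set can be partitioned into a clique and an
independent set. -/
def SimpleGraph.IsSplitGraph {X : Type} (G : SimpleGraph X) : Prop :=
  ∃ K : Set X, G.IsClique K ∧ ∀ u ∈ Kᶜ, ∀ v ∈ Kᶜ, ¬ G.Adj u v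

namespace SimpleGraph

variable {V : Type} {G : SimpleGraph V}

/-- A connected set stays connected after adding some of its neighbours. -/
lemma induce_union_connected_of_forall_adj {C J : Set V} (hC : (G.induce C).Connected)
    (hJ : ∀ v ∈ J, ∃ u ∈ C, G.Adj u v) : (G.induce (C ∪ J)).Connected := by
  obtain ⟨⟨c, hc⟩⟩ := hC.nonempty
  refine induce_connected_of_patches c (Or.inl hc) ?_
  rintro v (hv | hv)
  · exact ⟨C, Set.subset_union_left, hc, hv, hC.preconnected _ _⟩
  · obtain ⟨u, hu, huv⟩ := hJ v hv
    refine ⟨C ∪ {u, v}, ?_, Or.inl hc, Or.inr (by simp), ?_⟩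
    · rintro x (hx | rfl | rfl)
      exacts [Or.inl hx, Or.inl hu, Or.inr hv]
    · exact (hC.preconnected ⟨c, hc⟩ ⟨u, hu⟩).map
        (induceHomOfLE G Set.subset_union_left).toHom |>.trans
        (Adj.reachable (G := G.induce (C ∪ {u, v})) (u := ⟨u, Or.inl hu⟩) huv)

/-- Every vertex of `T` lies in a connected component of `G[T]`, seen as a set of vertices. -/
lemma exists_connected_subset_closed [Finite V] (G : SimpleGraph V) {T : Set V} {a : V}
    (ha : a ∈ T) :
    ∃ C ⊆ T, a ∈ C ∧ (G.induce C).Connected ∧ ∀ u ∈ C, ∀ v ∈ T, G.Adj u v → v ∈ C := by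
  obtain ⟨C, -, hmax⟩ := (Set.toFinite {C : Set V | C ⊆ T ∧ a ∈ C ∧ (G.induce C).Connected}
    ).exists_le_maximal (a := {a}) ⟨by simpa using ha, rfl, by
      have : Subsingleton ({a} : Set V) := Unique.instSubsingleton
      exact { preconnected := fun u v => Subsingleton.elim u v ▸ Reachable.refl _
              nonempty := ⟨⟨a, rfl⟩⟩ }⟩
  obtain ⟨hCT, haC, hC⟩ := hmax.prop
  refine ⟨C, hCT, haC, hC, fun u hu v hv huv => ?_⟩
  refine hmax.le_of_ge (y := C ∪ {v}) ⟨?_, Or.inl haC, ?_⟩ Set.subset_union_left (Or.inr rfl)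
  · exact Set.union_subset hCT (by simpa using hv)
  · exact induce_union_connected_of_forall_adj hC (by rintro _ rfl; exact ⟨u, hu, huv⟩)

/-- Contracting the connected set `C` together with a set `I` of its neighbours yields a colouring
of the rest of a minor-critical graph that is constant on the independent set `I` and does not
repeat the colour of `I` on the other neighbours of `C`. -/
lemma MinorCritical.exists_coloring_contract [Finite V] {n : ℕ} (hG : G.MinorCritical (n + 1))
    {X C I : Set V} {i : V} (hC : (G.induce C).Connected) (hXC : Disjoint X C)
    (hI : ∀ u ∈ I, ∀ v ∈ I, ¬ G.Adj u v) (hIC : ∀ v ∈ I, ∃ u ∈ C, G.Adj u v)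
    (hiX : i ∈ X) (hi : I.Nonempty → i ∈ I) :
    ∃ c : V → Fin n, (∀ u ∈ X, ∀ v ∈ X, G.Adj u v → c u ≠ c v) ∧
      (∀ u ∈ I, ∀ v ∈ I, c u = c v) ∧
      (∀ u ∈ I, ∀ v ∈ X, v ∉ I → (∃ w ∈ C, G.Adj w v) → c u ≠ c v) := by
  classical
  let W := {v : V // v ∈ X ∧ (v ∈ I → v = i)}
  let f : W → Set V := fun w => if w.1 ∈ I then C ∪ I else {w.1}
  let H : SimpleGraph W := SimpleGraph.fromRel fun w₁ w₂ => ∃ u ∈ f w₁, ∃ v ∈ f w₂, G.Adj u v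
  have hadj {w₁ w₂ : W} (hne : w₁ ≠ w₂) (h : ∃ u ∈ f w₁, ∃ v ∈ f w₂, G.Adj u v) :
      H.Adj w₁ w₂ := ⟨hne, Or.inl h⟩
  have hminor : H.MinorOf G := by
    refine ⟨f, fun w => ?_, fun w => ?_, fun w₁ w₂ hne => ?_, ?_⟩
    · by_cases hw : w.1 ∈ I
      · exact ⟨w.1, by simp [f, hw]⟩
      · exact ⟨w.1, by simp [f, hw]⟩
    · by_cases hw : w.1 ∈ I
      · have hfw : f w = C ∪ I := if_pos hw
        exact hfw ▸ induce_union_connected_of_forall_adj hC hIC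
      · have : Subsingleton (f w) := by simp only [f, if_neg hw]; infer_instance
        exact { preconnected := fun u v => Subsingleton.elim u v ▸ Reachable.refl _
                nonempty := ⟨⟨w.1, by simp [f, hw]⟩⟩ }
    · have hdisj (w : W) (hw : w.1 ∉ I) : w.1 ∉ C ∪ I := fun h =>
        h.elim (Set.disjoint_left.1 hXC w.2.1) hw
      have hne' : w₁.1 ≠ w₂.1 := fun h => hne (Subtype.ext h)
      by_cases h₁ : w₁.1 ∈ I <;> by_cases h₂ : w₂.1 ∈ I
      · exact absurd ((w₁.2.2 h₁).trans (w₂.2.2 h₂).symm) hne'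
      · simpa only [f, if_pos h₁, if_neg h₂, Set.disjoint_singleton_right] using hdisj w₂ h₂
      · simpa only [f, if_neg h₁, if_pos h₂, Set.disjoint_singleton_left] using hdisj w₁ h₁
      · simpa only [f, if_neg h₁, if_neg h₂, Set.disjoint_singleton] using hne'
    · rintro w₁ w₂ ⟨-, h | ⟨u, hu, v, hv, h⟩⟩
      exacts [h, ⟨v, hv, u, hu, h.symm⟩]
  have hiso : IsEmpty (H ≃g G) := by
    refine ⟨fun e => ?_⟩
    obtain ⟨⟨c, hc⟩⟩ := hC.nonempty
    have hsurj : Function.Surjective (Subtype.val : W → V) :=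
      ((Function.Injective.of_comp_iff (Subtype.val_injective) _).2 e.symm.injective |>
        Finite.surjective_of_injective).of_comp
    obtain ⟨w, rfl⟩ := hsurj c
    exact Set.disjoint_left.1 hXC w.2.1 hc
  obtain ⟨col⟩ : H.Colorable n := by
    have := hG.2 W H hminor hiso
    rw [← chromaticNumber_le_iff_colorable]
    exact ENat.lt_natCast_add_one_iff.1 (by exact_mod_cast this)
  have hiW : i ∈ X ∧ (i ∈ I → i = i) := ⟨hiX, fun _ => rfl⟩
  let c : V → Fin n := fun v => if h : v ∈ X ∧ v ∉ I then col ⟨v, h.1, fun h' => absurd h' h.2⟩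
    else col ⟨i, hiW⟩
  have hcI {v : V} (hv : v ∈ I) : c v = col ⟨i, hiW⟩ := dif_neg fun h => h.2 hv
  have hcX {v : V} (hv : v ∈ X) (hvI : v ∉ I) : c v = col ⟨v, hv, fun h => absurd h hvI⟩ :=
    dif_pos ⟨hv, hvI⟩
  have hmixed {u v : V} (hu : u ∈ I) (hv : v ∈ X) (hvI : v ∉ I)
      (h : ∃ w ∈ C ∪ I, G.Adj w v) : c u ≠ c v := by
    have hiI := hi ⟨u, hu⟩
    rw [hcI hu, hcX hv hvI]
    refine col.valid (hadj (fun h => hvI (by rwa [← show i = v from congrArg Subtype.val h])) ?_)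
    obtain ⟨w, hw, hwv⟩ := h
    exact ⟨w, by simpa only [f, if_pos hiI] using hw, v, by simp [f, hvI], hwv⟩
  refine ⟨c, fun u hu v hv huv => ?_, fun u hu v hv => (hcI hu).trans (hcI hv).symm,
    fun u hu v hv hvI ⟨w, hw, hwv⟩ => hmixed hu hv hvI ⟨w, Or.inl hw, hwv⟩⟩
  by_cases huI : u ∈ I <;> by_cases hvI : v ∈ I
  · exact absurd huv (hI u huI v hvI)
  · exact hmixed huI hv hvI ⟨u, Or.inr huI, huv⟩
  · exact (hmixed hvI hu huI ⟨v, Or.inr hvI, huv.symm⟩).symm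
  · rw [hcX hu huI, hcX hv hvI]
    exact col.valid (hadj (fun h => huv.ne (congrArg Subtype.val h))
      ⟨u, by simp [f, huI], v, by simp [f, hvI], huv⟩)

/-- Two functions to `Fin n` with the same kernel on `S` differ on `S` by a permutation. -/
lemma exists_perm_eqOn {n : ℕ} {S : Set V} {c d : V → Fin n}
    (h : ∀ u ∈ S, ∀ v ∈ S, c u = c v ↔ d u = d v) :
    ∃ σ : Equiv.Perm (Fin n), ∀ v ∈ S, σ (c v) = d v := by
  classical
  let g : Fin n → Fin n := fun x => if hx : ∃ v ∈ S, c v = x then d hx.choose else x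
  have hg (v : V) (hv : v ∈ S) : g (c v) = d v := by
    have hx : ∃ u ∈ S, c u = c v := ⟨v, hv, rfl⟩
    simp only [g, dif_pos hx]
    exact (h _ hx.choose_spec.1 _ hv).1 hx.choose_spec.2
  have hinj : Set.InjOn g (c '' S) := by
    rintro _ ⟨u, hu, rfl⟩ _ ⟨v, hv, rfl⟩ huv
    rw [hg u hu, hg v hv] at huv
    exact (h u hu v hv).2 huv
  obtain ⟨e, he⟩ := Set.MapsTo.exists_equiv_extend_of_card_eq (s := c '' S)
    (t := (Finset.univ : Finset (Fin n))) (f := g) (by simp) (fun _ _ => by simp) hinj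
  refine ⟨e.trans (Equiv.subtypeUnivEquiv (by simp)), fun v hv => ?_⟩
  exact (he _ ⟨v, hv, rfl⟩).trans (hg v hv)

/-- Colourings of the two sides of a separation that agree up to kernel on the separator glue. -/
lemma colorable_of_separation {n : ℕ} {D S : Set V} {c d : V → Fin n}
    (hS : ∀ u ∈ D, ∀ v ∉ D, G.Adj u v → v ∈ S)
    (hc : ∀ u ∈ D ∪ S, ∀ v ∈ D ∪ S, G.Adj u v → c u ≠ c v)
    (hd : ∀ u ∈ Dᶜ, ∀ v ∈ Dᶜ, G.Adj u v → d u ≠ d v)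
    (h : ∀ u ∈ S, ∀ v ∈ S, c u = c v ↔ d u = d v) : G.Colorable n := by
  classical
  obtain ⟨σ, hσ⟩ := exists_perm_eqOn h
  have hmixed {u v : V} (hu : u ∈ D) (hv : v ∉ D) (huv : G.Adj u v) : σ (c u) ≠ d v := by
    have hvS := hS u hu v hv huv
    rw [← hσ v hvS]
    exact σ.injective.ne (hc u (Or.inl hu) v (Or.inr hvS) huv)
  refine ⟨Coloring.mk (fun v => if v ∈ D then σ (c v) else d v) fun {u v} huv => ?_⟩
  by_cases hu : u ∈ D <;> by_cases hv : v ∈ D <;> simp only [hu, hv, if_true, if_false]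
  · exact σ.injective.ne (hc u (Or.inl hu) v (Or.inl hv) huv)
  · exact hmixed hu hv huv
  · exact (hmixed hv hu huv.symm).symm
  · exact hd u hu v hv huv

/-- Every separator contains a separator `S` attached completely to connected sets `C` and `D` on
its two sides, where `S` is the neighbourhood of `D`. -/
lemma exists_full_separation [Finite V] {A B : Set V} (hunion : A ∪ B = Set.univ)
    (hA : (A \ B).Nonempty) (hB : (B \ A).Nonempty)
    (hsep : ∀ a ∈ A \ B, ∀ b ∈ B \ A, ¬ G.Adj a b) :
    ∃ C D S : Set V, (G.induce C).Connected ∧ (G.induce D).Connected ∧ S ⊆ A ∩ B ∧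
      Disjoint C D ∧ Disjoint S C ∧ Disjoint S D ∧
      (∀ u ∈ D, ∀ v ∉ D, G.Adj u v → v ∈ S) ∧
      (∀ v ∈ S, ∃ u ∈ C, G.Adj u v) ∧ (∀ v ∈ S, ∃ u ∈ D, G.Adj u v) := by
  obtain ⟨a, ha⟩ := hA
  obtain ⟨b, hb⟩ := hB
  obtain ⟨C, hCA, -, hC, hCcl⟩ := exists_connected_subset_closed G ha
  have hCN (u : V) (hu : u ∈ C) (v : V) (hv : v ∉ C) (huv : G.Adj u v) : v ∈ A ∩ B := by
    have hvAB : v ∈ A ∪ B := hunion ▸ Set.mem_univ v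
    have h₁ : v ∉ A \ B := fun h => hv (hCcl u hu v h huv)
    have h₂ : v ∉ B \ A := fun h => hsep u (hCA hu) v h huv
    simp only [Set.mem_sdiff, Set.mem_union, Set.mem_inter_iff] at *
    tauto
  have hbT : b ∈ {v | v ∉ C ∧ ∀ u ∈ C, ¬ G.Adj u v} :=
    ⟨fun h => hb.2 (hCA h).1, fun u hu => hsep u (hCA hu) b hb⟩
  obtain ⟨D, hDT, -, hD, hDcl⟩ := exists_connected_subset_closed G hbT
  have hSC (v : V) (hv : v ∉ D) (h : ∃ u ∈ D, G.Adj u v) : v ∉ C ∧ ∃ u ∈ C, G.Adj u v := by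
    obtain ⟨u, hu, huv⟩ := h
    have hvC : v ∉ C := fun hvC => (hDT hu).2 v hvC huv.symm
    refine ⟨hvC, ?_⟩
    by_contra! hcon
    exact hv (hDcl u hu v ⟨hvC, hcon⟩ huv)
  refine ⟨C, D, {v | v ∉ D ∧ ∃ u ∈ D, G.Adj u v}, hC, hD, ?_, ?_, ?_, ?_, ?_, ?_, ?_⟩
  · rintro v ⟨hv, h⟩
    obtain ⟨hvC, u, hu, huv⟩ := hSC v hv h
    exact hCN u hu v hvC huv
  · exact Set.disjoint_right.2 fun v hv => (hDT hv).1
  · exact Set.disjoint_left.2 fun v hv => (hSC v hv.1 hv.2).1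
  · exact Set.disjoint_left.2 fun v hv => hv.1
  · exact fun u hu v hv huv => ⟨hv, u, hu, huv⟩
  · exact fun v hv => (hSC v hv.1 hv.2).2
  · exact fun v hv => hv.2

end SimpleGraph

/-- In a `k`-minor-critical finite graph, for every separation `(A, B)` the
induced subgraph `G[A ∩ B]` is not a split graph. -/
theorem statement12 {V : Type} [Fintype V] (G : SimpleGraph V)
    (k : ℕ) (hcrit : G.MinorCritical k)
    (A B : Set V) (hunion : A ∪ B = Set.univ)
    (hA : (A \ B).Nonempty) (hB : (B \ A).Nonempty)
    (hsep : ∀ a ∈ A \ B, ∀ b ∈ B \ A, ¬ G.Adj a b) :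
    ¬ (G.induce (A ∩ B)).IsSplitGraph := by
  rintro ⟨K, hK, hI⟩
  obtain ⟨C, D, S, hC, hD, hSAB, hCD, hSC, hSD, hDN, hSCadj, hSDadj⟩ :=
    exists_full_separation hunion hA hB hsep
  obtain ⟨⟨x, hx⟩⟩ := hC.nonempty
  obtain ⟨⟨y, hy⟩⟩ := hD.nonempty
  obtain _ | n := k
  · have := chromaticNumber_le_iff_colorable.1 hcrit.1.le
    exact (this.some x).elim0
  let I : Set V := {v | v ∈ S ∧ ∀ h : v ∈ A ∩ B, (⟨v, h⟩ : (A ∩ B : Set V)) ∉ K}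
  have hIS : I ⊆ S := fun v hv => hv.1
  have hIind : ∀ u ∈ I, ∀ v ∈ I, ¬ G.Adj u v := fun u hu v hv =>
    hI ⟨u, hSAB hu.1⟩ (hu.2 _) ⟨v, hSAB hv.1⟩ (hv.2 _)
  have hclique : ∀ u ∈ S, u ∉ I → ∀ v ∈ S, v ∉ I → u ≠ v → G.Adj u v := by
    intro u hu huI v hv hvI huv
    have hmem (w : V) (hw : w ∈ S) (hwI : w ∉ I) : (⟨w, hSAB hw⟩ : (A ∩ B : Set V)) ∈ K := by
      by_contra hcon
      exact hwI ⟨hw, fun _ => hcon⟩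
    exact hK (hmem u hu huI) (hmem v hv hvI) fun h => huv (congrArg Subtype.val h)
  have hrep (z : V) : ∃ i, (i = z ∨ i ∈ S) ∧ (I.Nonempty → i ∈ I) := by
    by_cases h : I.Nonempty
    · exact ⟨h.some, Or.inr (hIS h.some_mem), fun _ => h.some_mem⟩
    · exact ⟨z, Or.inl rfl, fun h' => absurd h' h⟩
  obtain ⟨i, hiX, hi⟩ := hrep y
  obtain ⟨j, hjX, hj⟩ := hrep x
  have hSD' : S ⊆ Dᶜ := fun v hv => Set.disjoint_left.1 hSD hv
  obtain ⟨c, hc, hcI, hcK⟩ := hcrit.exists_coloring_contract (X := D ∪ S) hC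
    (Set.disjoint_union_left.2 ⟨hCD.symm, hSC⟩) hIind
    (fun v hv => hSCadj v (hIS hv)) (hiX.imp (fun h => h ▸ hy) id) hi
  obtain ⟨d, hd, hdI, hdK⟩ := hcrit.exists_coloring_contract (X := Dᶜ) hD
    disjoint_compl_left hIind (fun v hv => hSDadj v (hIS hv))
    (hjX.elim (fun h => h ▸ Set.disjoint_left.1 hCD hx) fun h => hSD' h) hj
  have hcol : G.Colorable n := by
    refine colorable_of_separation hDN hc hd fun u hu v hv => ?_
    by_cases huI : u ∈ I <;> by_cases hvI : v ∈ I
    · exact iff_of_true (hcI u huI v hvI) (hdI u huI v hvI)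
    · exact iff_of_false (hcK u huI v (Or.inr hv) hvI (hSCadj v hv))
        (hdK u huI v (hSD' hv) hvI (hSDadj v hv))
    · exact iff_of_false (hcK v hvI u (Or.inr hu) huI (hSCadj u hu)).symm
        (hdK v hvI u (hSD' hu) huI (hSDadj u hu)).symm
    · obtain rfl | huv := eq_or_ne u v
      · exact iff_of_true rfl rfl
      · have hadj := hclique u hu huI v hv hvI huv
        exact iff_of_false (hc u (Or.inr hu) v (Or.inr hv) hadj) (hd u (hSD' hu) v (hSD' hv) hadj)
  have hle := chromaticNumber_le_iff_colorable.2 hcol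
  rw [hcrit.1] at hle
  have : n + 1 ≤ n := by exact_mod_cast hle
  omega
end
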